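/- arXiv:0909.0670 — 4 statements merged into one kernel-verified Lean document; each statement's English description precedes it below -/
import Mathlib

section
/- Let a,b,c be positive integers such that w=a+b+c is even, and let p be a prime with p \ge w+3. Writing H(-)=H(-;p-1), one has H(a,-b,-c) \equiv -\sum_{k=2}^{p-w+1} \binom{p-a}{p-w-k+1}\binom{k+c-1}{c} \frac{(1-2^k) B_k B_{p-w-k+1}}{ak} - \sum_{k=p+1-b-c}^{p-c} \binom{p-a}{2p-w-k}\binom{k+c-1}{c} \frac{(1-2^k) B_k B_{2p-w-k}}{ak} - \frac{(1-2^{p-c})(1-2^{p-a-b}) B_{p-a-b} B_{p-c}}{(a+b)c} \pmod{p}. -/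
open Finset

/-- sign of an integer as a rational: `-1` if negative, else `1`. -/
def sgn (s : ℤ) : ℚ := if s < 0 then -1 else 1

/-- Auxiliary: alternating multiple harmonic sum with the index list reversed
    (head of the list corresponds to the outermost, i.e. largest, summation index). -/
def Hrev : List ℤ → ℕ → ℚ
  | [], _ => 1
  | s :: t, n => ∑ k ∈ Finset.Icc 1 n, (sgn s) ^ k / (k : ℚ) ^ s.natAbs * Hrev t (k - 1)

/-- The alternating multiple harmonic sum `H(s₁,…,s_d; n)`:
    the sum over `1 ≤ k₁ < ⋯ < k_d ≤ n` of `∏ sign(sᵢ)^{kᵢ}/kᵢ^{|sᵢ|}`. -/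
def H (s : List ℤ) (n : ℕ) : ℚ := Hrev s.reverse n

/-- Auxiliary for the non-strict version. -/
def Srev : List ℤ → ℕ → ℚ
  | [], _ => 1
  | s :: t, n => ∑ k ∈ Finset.Icc 1 n, (sgn s) ^ k / (k : ℚ) ^ s.natAbs * Srev t k

/-- The non-strict alternating multiple harmonic sum `S(s₁,…,s_d; n)`:
    the sum over `1 ≤ k₁ ≤ ⋯ ≤ k_d ≤ n`. -/
def S (s : List ℤ) (n : ℕ) : ℚ := Srev s.reverse n

/-- `x ≡ y (mod m)` for rationals: the numerator of `x - y` in lowest terms is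
    divisible by `m`. -/
def pcong (m : ℕ) (x y : ℚ) : Prop := (m : ℤ) ∣ (x - y).num

/-- The Fermat quotient of 2 : `q_p = (2^{p-1}-1)/p`. -/
def qp (p : ℕ) : ℚ := (2 ^ (p - 1) - 1) / p

/-- `s ⊕ t = sign(st)(|s|+|t|)`, with the convention that `0 ⊕ t = t` and `s ⊕ 0 = s`. -/
def oplus (s t : ℤ) : ℤ :=
  if s = 0 then t else if t = 0 then s else (s * t).sign * (|s| + |t|)

/-- The value `E_n(0)` of the `n`-th Euler polynomial at zero. -/
def eulerZero (n : ℕ) : ℚ := 2 * (1 - 2 ^ (n + 1)) * bernoulli (n + 1) / (n + 1)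

/-- The `n`-th Euler polynomial, evaluated at a rational number. -/
def eulerEval (n : ℕ) (x : ℚ) : ℚ :=
  ∑ i ∈ range (n + 1), (n.choose i : ℚ) * eulerZero i * x ^ (n - i)

lemma eulerZero_of_even {n : ℕ} (hn : Even n) (h0 : n ≠ 0) : eulerZero n = 0 := by
  rw [eulerZero, bernoulli_eq_zero_of_odd hn.add_one (by omega)]
  simp

lemma eulerEval_zero (n : ℕ) : eulerEval n 0 = eulerZero n := by
  rw [eulerEval, sum_range_succ, sum_eq_zero]
  · simp
  · intro i hi
    rw [mem_range] at hi
    simp [show n - i ≠ 0 by omega]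

lemma bernoulli_eval_two_mul (k : ℕ) (x : ℚ) :
    (Polynomial.bernoulli k).eval (2 * x) = 2 ^ k / 2 *
      ((Polynomial.bernoulli k).eval x + (Polynomial.bernoulli k).eval (x + 1 / 2)) := by
  have key (y : ℚ) :
      bernoulliFun k (y : ℝ) = (((Polynomial.bernoulli k).eval y : ℚ) : ℝ) := by
    rw [bernoulliFun, ← eq_ratCast (algebraMap ℚ ℝ) y, Polynomial.eval_map_algebraMap,
      Polynomial.aeval_algebraMap_apply, Polynomial.coe_aeval_eq_eval, eq_ratCast]
  have h := bernoulliFun_mul k (two_ne_zero) (x : ℝ)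
  have h1 := key (2 * x)
  have h2 := key x
  have h3 := key (x + 1 / 2)
  push_cast at h1 h3
  simp only [sum_range_succ, sum_range_zero, Nat.cast_ofNat, Nat.cast_zero, Nat.cast_one,
    zero_div, add_zero, zero_add, h1, h2, h3] at h
  apply Rat.cast_injective (α := ℝ)
  push_cast
  exact h

lemma eulerEval_eq_bernoulli (n : ℕ) (x : ℚ) :
    (n + 1) * eulerEval n x = 2 * ((Polynomial.bernoulli (n + 1)).eval x -
      2 ^ (n + 1) * (Polynomial.bernoulli (n + 1)).eval (x / 2)) := by
  have eval_eq (y : ℚ) : (Polynomial.bernoulli (n + 1)).eval y = ∑ i ∈ range (n + 2),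
      bernoulli i * ((n + 1).choose i : ℚ) * y ^ (n + 1 - i) := by
    simp [Polynomial.bernoulli, Polynomial.eval_finsetSum]
  rw [eval_eq, eval_eq, mul_sum, ← sum_sub_distrib, sum_range_succ', mul_add, eulerEval, mul_sum,
    mul_sum]
  have hz : (2 : ℚ) * (bernoulli 0 * ((n + 1).choose 0 : ℚ) * x ^ (n + 1 - 0) -
      2 ^ (n + 1) * (bernoulli 0 * ((n + 1).choose 0 : ℚ) * (x / 2) ^ (n + 1 - 0))) = 0 := by
    simp [div_pow]
    field_simp
    simp
  rw [hz, add_zero]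
  refine sum_congr rfl fun i hi => ?_
  have hin : i ≤ n := Nat.lt_succ_iff.mp (mem_range.mp hi)
  have hch : ((n : ℚ) + 1) * (n.choose i : ℚ) = ((n + 1).choose (i + 1) : ℚ) * (i + 1) := by
    exact_mod_cast Nat.add_one_mul_choose_eq n i
  have hpow : (2 : ℚ) ^ (n + 1) = 2 ^ (n - i) * 2 ^ (i + 1) := by
    rw [← pow_add]
    congr 1
    omega
  have hi0 : (i : ℚ) + 1 ≠ 0 := by positivity
  rw [Nat.add_sub_add_right, hpow, div_pow, eulerZero]
  field_simp
  linear_combination ((1 - (2 : ℚ) ^ (i + 1)) * bernoulli (i + 1) * x ^ (n - i)) * hch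

lemma eulerEval_add_one (n : ℕ) (x : ℚ) :
    eulerEval n (x + 1) + eulerEval n x = 2 * x ^ n := by
  have hn : (n : ℚ) + 1 ≠ 0 := by positivity
  have h1 := eulerEval_eq_bernoulli n x
  have h2 := eulerEval_eq_bernoulli n (x + 1)
  have h3 := Polynomial.bernoulli_eval_one_add (n + 1) x
  have h4 := bernoulli_eval_two_mul (n + 1) (x / 2)
  rw [add_comm 1 x, Nat.add_sub_cancel] at h3
  rw [mul_div_cancel₀ x two_ne_zero, ← add_div] at h4
  push_cast at h3
  apply mul_left_cancel₀ hn
  linear_combination h1 + h2 + 2 * h3 + 4 * h4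

lemma two_mul_alternating_sum_pow (n m : ℕ) :
    2 * ∑ k ∈ range m, (-1 : ℚ) ^ k * (k : ℚ) ^ n =
      eulerZero n - (-1) ^ m * eulerEval n m := by
  induction m with
  | zero => simp [eulerEval_zero]
  | succ m ih =>
    rw [sum_range_succ, mul_add, ih, Nat.cast_succ, pow_succ]
    linear_combination (-(-1 : ℚ) ^ m) * eulerEval_add_one n m

lemma eulerZero_recurrence (n : ℕ) :
    2 * eulerZero n = 2 * 0 ^ n - ∑ i ∈ range n, (n.choose i : ℚ) * eulerZero i := by
  have h := eulerEval_add_one n 0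
  rw [eulerEval_zero, zero_add, eulerEval, sum_range_succ] at h
  simp only [one_pow, mul_one, Nat.choose_self, Nat.cast_one, one_mul] at h
  linear_combination h

/-- The rational number `x` is `p`-integral with residue `z` modulo `p`. -/
def Reduces (p : ℕ) (x : ℚ) (z : ZMod p) : Prop :=
  ∃ n d : ℤ, (d : ZMod p) ≠ 0 ∧ x * d = n ∧ z * d = n

namespace Reduces

variable {p : ℕ} {x y : ℚ} {z u : ZMod p}

lemma intCast [Fact p.Prime] (n : ℤ) : Reduces p n n := ⟨n, 1, by simp, by simp, by simp⟩

lemma natCast [Fact p.Prime] (n : ℕ) : Reduces p n n := by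
  simpa using intCast (p := p) (n : ℤ)

lemma zero [Fact p.Prime] : Reduces p 0 0 := by simpa using natCast (p := p) 0

lemma one [Fact p.Prime] : Reduces p 1 1 := by simpa using natCast (p := p) 1

lemma two [Fact p.Prime] : Reduces p 2 2 := by simpa using natCast (p := p) 2

lemma neg (hx : Reduces p x z) : Reduces p (-x) (-z) := by
  obtain ⟨n, d, hd, hn, hm⟩ := hx
  exact ⟨-n, d, hd, by push_cast; rw [← hn]; ring, by push_cast; rw [← hm]; ring⟩

lemma add [Fact p.Prime] (hx : Reduces p x z) (hy : Reduces p y u) :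
    Reduces p (x + y) (z + u) := by
  obtain ⟨n, d, hd, hn, hm⟩ := hx
  obtain ⟨n', d', hd', hn', hm'⟩ := hy
  refine ⟨n * d' + n' * d, d * d', ?_, ?_, ?_⟩
  · push_cast
    exact mul_ne_zero hd hd'
  · push_cast
    rw [← hn, ← hn']
    ring
  · push_cast
    rw [← hm, ← hm']
    ring

lemma sub [Fact p.Prime] (hx : Reduces p x z) (hy : Reduces p y u) :
    Reduces p (x - y) (z - u) := by
  simpa [sub_eq_add_neg] using hx.add hy.neg

lemma mul [Fact p.Prime] (hx : Reduces p x z) (hy : Reduces p y u) :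
    Reduces p (x * y) (z * u) := by
  obtain ⟨n, d, hd, hn, hm⟩ := hx
  obtain ⟨n', d', hd', hn', hm'⟩ := hy
  refine ⟨n * n', d * d', ?_, ?_, ?_⟩
  · push_cast
    exact mul_ne_zero hd hd'
  · push_cast
    rw [← hn, ← hn']
    ring
  · push_cast
    rw [← hm, ← hm']
    ring

lemma inv [Fact p.Prime] (hx : Reduces p x z) (hz : z ≠ 0) : Reduces p x⁻¹ z⁻¹ := by
  obtain ⟨n, d, hd, hn, hm⟩ := hx
  have hn0 : (n : ZMod p) ≠ 0 := hm ▸ mul_ne_zero hz hd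
  have hn0' : (n : ℚ) ≠ 0 := by
    rintro h
    rw [Int.cast_eq_zero] at h
    simp [h] at hn0
  have hx0 : x ≠ 0 := by
    rintro rfl
    exact hn0' (by rw [← hn, zero_mul])
  refine ⟨d, n, hn0, ?_, ?_⟩
  · rw [← hn, inv_mul_cancel_left₀ hx0]
  · rw [← hm, inv_mul_cancel_left₀ hz]

lemma div [Fact p.Prime] (hx : Reduces p x z) (hy : Reduces p y u) (hu : u ≠ 0) :
    Reduces p (x / y) (z / u) := by
  simpa [div_eq_mul_inv] using hx.mul (hy.inv hu)

lemma pow [Fact p.Prime] (hx : Reduces p x z) (n : ℕ) : Reduces p (x ^ n) (z ^ n) := by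
  induction n with
  | zero => simpa using one
  | succ n ih => simpa [pow_succ] using ih.mul hx

lemma sum [Fact p.Prime] {ι : Type*} (s : Finset ι) {f : ι → ℚ} {g : ι → ZMod p}
    (h : ∀ i ∈ s, Reduces p (f i) (g i)) : Reduces p (∑ i ∈ s, f i) (∑ i ∈ s, g i) := by
  induction s using Finset.cons_induction with
  | empty => simpa using zero
  | cons a s ha ih =>
    rw [sum_cons, sum_cons]
    exact (h a (mem_cons_self a s)).add (ih fun i hi => h i (mem_cons_of_mem hi))

lemma num_dvd [Fact p.Prime] (hx : Reduces p x 0) : (p : ℤ) ∣ x.num := by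
  obtain ⟨n, d, hd, hn, hm⟩ := hx
  rw [zero_mul, eq_comm] at hm
  have hcross : x.num * d = n * x.den := by
    have h := x.num_div_den
    have hden : (x.den : ℚ) ≠ 0 := by exact_mod_cast x.den_ne_zero
    rw [div_eq_iff hden] at h
    have : (x.num : ℚ) * d = n * x.den := by rw [h, ← hn]; ring
    exact_mod_cast this
  rw [← ZMod.intCast_zmod_eq_zero_iff_dvd]
  have := congrArg (Int.cast : ℤ → ZMod p) hcross
  push_cast at this
  rw [hm, zero_mul] at this
  exact (mul_eq_zero.mp this).resolve_right hd

lemma pcong [Fact p.Prime] (hx : Reduces p x z) (hy : Reduces p y z) : pcong p x y :=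
  num_dvd (by simpa using hx.sub hy)

lemma unique [Fact p.Prime] (hx : Reduces p x z) (hy : Reduces p x u) : z = u := by
  obtain ⟨n, d, hd, hn, hm⟩ := hx
  obtain ⟨n', d', hd', hn', hm'⟩ := hy
  have h : n * d' = n' * d := by
    have : (n : ℚ) * d' = n' * d := by rw [← hn, ← hn']; ring
    exact_mod_cast this
  have h' := congrArg (Int.cast : ℤ → ZMod p) h
  push_cast at h'
  rw [← hm, ← hm'] at h'
  apply mul_right_cancel₀ (mul_ne_zero hd hd')
  linear_combination h'

end Reduces

section

variable {p : ℕ} [Fact p.Prime]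

lemma natCast_zmod_ne_zero {n : ℕ} (h0 : 0 < n) (hn : n < p) : (n : ZMod p) ≠ 0 := by
  rw [Ne, ZMod.natCast_eq_zero_iff]
  exact Nat.not_dvd_of_pos_of_lt h0 hn

lemma two_zmod_ne_zero (hp : 2 < p) : (2 : ZMod p) ≠ 0 := by
  exact_mod_cast natCast_zmod_ne_zero two_pos hp

lemma exists_reduces_bernoulli (n : ℕ) (hn : n + 1 < p) : ∃ z, Reduces p (bernoulli n) z := by
  induction n using Nat.strong_induction_on with
  | _ n ih =>
    choose! f hf using ih
    have h := sum_bernoulli (n + 1)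
    rw [sum_range_succ, Nat.choose_succ_self_right] at h
    have hn0 : ((n + 1 : ℕ) : ℚ) ≠ 0 := by positivity
    have hb : bernoulli n = ((if n + 1 = 1 then (1 : ℚ) else 0) -
        ∑ k ∈ range n, ((n + 1).choose k : ℚ) * bernoulli k) / ((n + 1 : ℕ) : ℚ) := by
      rw [eq_div_iff hn0]
      linear_combination h
    rw [hb]
    refine ⟨_, Reduces.div (Reduces.sub (z := if n + 1 = 1 then 1 else 0) ?_
      (Reduces.sum _ fun k hk => (Reduces.natCast _).mul (hf k (mem_range.mp hk) ?_)))
      (Reduces.natCast _) (natCast_zmod_ne_zero n.succ_pos hn)⟩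
    · split_ifs
      exacts [Reduces.one, Reduces.zero]
    · have := mem_range.mp hk
      omega

lemma exists_reduces_eulerZero (hp : 2 < p) (n : ℕ) : ∃ z, Reduces p (eulerZero n) z := by
  induction n using Nat.strong_induction_on with
  | _ n ih =>
    choose! f hf using ih
    have h : eulerZero n =
        (2 * 0 ^ n - ∑ i ∈ range n, (n.choose i : ℚ) * eulerZero i) / 2 := by
      rw [← eulerZero_recurrence]
      ring
    rw [h]
    exact ⟨_, Reduces.div (Reduces.sub (Reduces.two.mul (Reduces.zero.pow n))
      (Reduces.sum _ fun k hk => (Reduces.natCast _).mul (hf k (mem_range.mp hk))))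
      Reduces.two (two_zmod_ne_zero hp)⟩

lemma sum_range_prime_pow {r : ℕ} (h0 : 0 < r) (hr : r < 2 * (p - 1)) :
    ∑ k ∈ range p, (k : ZMod p) ^ r = if r = p - 1 then -1 else 0 := by
  have hp := (Fact.out : p.Prime).pos
  have hunits : ∑ k ∈ Ico 1 p, (k : ZMod p) ^ r = ∑ u : (ZMod p)ˣ, (u : ZMod p) ^ r :=
    sum_bij'
      (fun k hk => Units.mk0 (k : ZMod p)
        (natCast_zmod_ne_zero (mem_Ico.mp hk).1 (mem_Ico.mp hk).2))
      (fun u _ => (u : ZMod p).val)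
      (fun _ _ => mem_univ _)
      (fun u _ => mem_Ico.mpr
        ⟨Nat.pos_of_ne_zero ((ZMod.val_ne_zero _).mpr u.ne_zero), ZMod.val_lt _⟩)
      (fun k hk => by simp [ZMod.val_cast_of_lt (mem_Ico.mp hk).2])
      (fun u _ => Units.ext (ZMod.natCast_zmod_val _))
      (fun _ _ => rfl)
  have hdvd : p - 1 ∣ r ↔ r = p - 1 := by
    refine ⟨?_, fun h => h ▸ dvd_rfl⟩
    rintro ⟨m, rfl⟩
    have hm2 : m < 2 := by
      by_contra! h
      have := Nat.mul_le_mul_left (p - 1) h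
      omega
    interval_cases m <;> simp_all
  rw [range_eq_Ico, sum_eq_sum_Ico_succ_bot hp, hunits, FiniteField.sum_pow_units, ZMod.card]
  simp [hdvd, h0.ne']

lemma pow_add_prime_sub_one (x : ZMod p) {n : ℕ} (hn : 0 < n) : x ^ (n + (p - 1)) = x ^ n := by
  have hp := (Fact.out : p.Prime).one_lt
  obtain ⟨m, rfl⟩ := Nat.exists_eq_succ_of_ne_zero hn.ne'
  rw [show m.succ + (p - 1) = m + p by omega, pow_add, ZMod.pow_card, pow_succ]

lemma reduces_Hrev_cons {s : ℤ} {t : List ℤ} {σ : ZMod p} {f : ℕ → ZMod p} {m : ℕ}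
    (hm : m ≤ p) (hs0 : 0 < s.natAbs) (hs : s.natAbs < p - 1) (hσ : Reduces p (sgn s) σ)
    (hf : ∀ k < p, Reduces p (Hrev t (k - 1)) (f k)) :
    Reduces p (Hrev (s :: t) (m - 1))
      (∑ k ∈ range m, σ ^ k * (k : ZMod p) ^ (p - 1 - s.natAbs) * f k) := by
  have hsum : ∑ k ∈ range m, σ ^ k * (k : ZMod p) ^ (p - 1 - s.natAbs) * f k =
      ∑ k ∈ Icc 1 (m - 1), σ ^ k * (k : ZMod p) ^ (p - 1 - s.natAbs) * f k := by
    symm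
    apply sum_subset
    · intro k hk
      rw [mem_Icc] at hk
      rw [mem_range]
      omega
    · intro k hk hk'
      rw [mem_range] at hk
      rw [mem_Icc] at hk'
      obtain rfl : k = 0 := by omega
      simp [show p - 1 - s.natAbs ≠ 0 by omega]
  rw [hsum, Hrev]
  refine Reduces.sum _ fun k hk => ?_
  rw [mem_Icc] at hk
  have hk0 : (k : ZMod p) ≠ 0 := natCast_zmod_ne_zero (by omega) (by omega)
  have hinv : (k : ZMod p) ^ (p - 1 - s.natAbs) = 1 / (k : ZMod p) ^ s.natAbs := by
    rw [eq_div_iff (pow_ne_zero _ hk0), ← pow_add, Nat.sub_add_cancel hs.le,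
      ZMod.pow_card_sub_one_eq_one hk0]
  rw [hinv, mul_one_div]
  exact ((hσ.pow k).div ((Reduces.natCast k).pow _) (pow_ne_zero _ hk0)).mul (hf k (by omega))

end

section

variable {p : ℕ} [Fact p.Prime]

lemma sum_range_pow_zmod {b : ℕ → ZMod p} (hb : ∀ i, i + 1 < p → Reduces p (bernoulli i) (b i))
    {r : ℕ} (hr : r + 1 < p) (m : ℕ) :
    ((r + 1 : ℕ) : ZMod p) * ∑ k ∈ range m, (k : ZMod p) ^ r =
      ∑ i ∈ range (r + 1), b i * ((r + 1).choose i : ZMod p) * (m : ZMod p) ^ (r + 1 - i) := by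
  have hL : Reduces p (((r + 1 : ℕ) : ℚ) * ∑ k ∈ range m, (k : ℚ) ^ r)
      (((r + 1 : ℕ) : ZMod p) * ∑ k ∈ range m, (k : ZMod p) ^ r) :=
    (Reduces.natCast _).mul (Reduces.sum _ fun k _ => (Reduces.natCast k).pow r)
  have hR : Reduces p
      (∑ i ∈ range (r + 1), bernoulli i * ((r + 1).choose i : ℚ) * (m : ℚ) ^ (r + 1 - i))
      (∑ i ∈ range (r + 1), b i * ((r + 1).choose i : ZMod p) * (m : ZMod p) ^ (r + 1 - i)) :=
    Reduces.sum _ fun i hi =>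
      ((hb i (by have := mem_range.mp hi; omega)).mul (Reduces.natCast _)).mul
        ((Reduces.natCast m).pow _)
  have hr0 : (r : ℚ) + 1 ≠ 0 := by positivity
  refine hL.unique ?_
  convert! hR using 1
  rw [sum_range_pow, ← sum_div, Nat.cast_succ, mul_div_cancel₀ _ hr0]

lemma two_mul_alternating_sum_pow_zmod {e : ℕ → ZMod p} (he : ∀ i, Reduces p (eulerZero i) (e i))
    (n m : ℕ) :
    2 * ∑ k ∈ range m, (-1 : ZMod p) ^ k * (k : ZMod p) ^ n =
      e n - (-1) ^ m * ∑ i ∈ range (n + 1), (n.choose i : ZMod p) * e i * (m : ZMod p) ^ (n - i) :=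
  have h1 : Reduces p (-1) (-1) := Reduces.one.neg
  (Reduces.two.mul (Reduces.sum _ fun k _ => (h1.pow k).mul ((Reduces.natCast k).pow n))).unique
    (two_mul_alternating_sum_pow n m ▸ (he n).sub ((h1.pow m).mul (Reduces.sum _ fun i _ =>
      ((Reduces.natCast _).mul (he i)).mul ((Reduces.natCast m).pow _))))

lemma alternating_sum_pow_range_prime {e : ℕ → ZMod p}
    (he : ∀ i, Reduces p (eulerZero i) (e i)) (hp : 2 < p) (n : ℕ) :
    ∑ k ∈ range p, (-1 : ZMod p) ^ k * (k : ZMod p) ^ n = e n := by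
  apply mul_left_cancel₀ (two_zmod_ne_zero hp)
  have hodd : Odd p := (Fact.out : p.Prime).odd_of_ne_two hp.ne'
  rw [two_mul_alternating_sum_pow_zmod he, hodd.neg_one_pow, sum_range_succ, sum_eq_zero]
  · simp
    ring
  · intro i hi
    have := mem_range.mp hi
    simp [show n - i ≠ 0 by omega]

/-- The depth-two alternating sum `H(-n, c)` modulo `p`, with a nonnegative inner power `n`. -/
lemma two_mul_double_alternating_sum {e : ℕ → ZMod p}
    (he : ∀ i, Reduces p (eulerZero i) (e i)) (hp : 2 < p) {n c : ℕ} (hn : n < p) (hc : 0 < c)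
    (hcp : c < p - 1) :
    2 * ∑ m ∈ range p, (-1 : ZMod p) ^ m * (m : ZMod p) ^ (p - 1 - c) *
        ∑ k ∈ range m, (-1 : ZMod p) ^ k * (k : ZMod p) ^ n =
      e n * e (p - 1 - c) + (n.choose c : ZMod p) * e (n - c) := by
  have expand : ∀ m : ℕ, 2 * ((-1 : ZMod p) ^ m * (m : ZMod p) ^ (p - 1 - c) *
        ∑ k ∈ range m, (-1 : ZMod p) ^ k * (k : ZMod p) ^ n) =
      e n * ((-1) ^ m * (m : ZMod p) ^ (p - 1 - c)) -
        ∑ i ∈ range (n + 1), (n.choose i : ZMod p) * e i * (m : ZMod p) ^ (p - 1 - c + (n - i)) := by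
    intro m
    have hsq : (-1 : ZMod p) ^ m * (-1) ^ m = 1 := by
      rw [← mul_pow]
      simp
    have hsum : ∑ i ∈ range (n + 1),
          (n.choose i : ZMod p) * e i * (m : ZMod p) ^ (p - 1 - c + (n - i)) =
        (m : ZMod p) ^ (p - 1 - c) *
          ∑ i ∈ range (n + 1), (n.choose i : ZMod p) * e i * (m : ZMod p) ^ (n - i) := by
      rw [mul_sum]
      exact sum_congr rfl fun i _ => by rw [pow_add]; ring
    rw [hsum]
    linear_combination ((-1 : ZMod p) ^ m * (m : ZMod p) ^ (p - 1 - c)) *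
      two_mul_alternating_sum_pow_zmod he n m - ((m : ZMod p) ^ (p - 1 - c) *
        ∑ i ∈ range (n + 1), (n.choose i : ZMod p) * e i * (m : ZMod p) ^ (n - i)) * hsq
  rw [mul_sum, sum_congr rfl fun m _ => expand m, sum_sub_distrib, ← mul_sum,
    alternating_sum_pow_range_prime he hp, sum_comm]
  have hinner : ∀ i ∈ range (n + 1), ∑ m ∈ range p,
      (n.choose i : ZMod p) * e i * (m : ZMod p) ^ (p - 1 - c + (n - i)) =
        if i + c = n then -((n.choose i : ZMod p) * e i) else 0 := by
    intro i hi
    have := mem_range.mp hi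
    rw [← mul_sum, sum_range_prime_pow (by omega) (by omega)]
    have hiff : p - 1 - c + (n - i) = p - 1 ↔ i + c = n := by omega
    simp only [hiff]
    split_ifs <;> simp
  rw [sum_congr rfl hinner]
  rcases le_or_gt c n with hcn | hcn
  · rw [sum_eq_single_of_mem (n - c) (mem_range.mpr (by omega))
      fun i hi hne => if_neg (by omega), if_pos (by omega), Nat.choose_symm hcn]
    ring
  · rw [Nat.choose_eq_zero_of_lt hcn, sum_eq_zero fun i _ => if_neg (by omega)]
    simp

end

/-- The representative in `{1, …, p - 1}` of `p - a - b - i` modulo `p - 1`, for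
`i ≤ p - 1 - a` and `b ≤ p - 1`. -/
def innerExponent (p a b i : ℕ) : ℕ :=
  if i < p - a - b then p - a - b - i else 2 * p - 1 - a - b - i

section

variable {p : ℕ} [Fact p.Prime]

lemma reduces_H (a b c : ℕ) (ha : 0 < a) (hb : 0 < b) (hc : 0 < c) (hap : a < p - 1)
    (hbp : b < p - 1) (hcp : c < p - 1) :
    Reduces p (H [(a : ℤ), -(b : ℤ), -(c : ℤ)] (p - 1))
      (∑ m ∈ range p, (-1 : ZMod p) ^ m * (m : ZMod p) ^ (p - 1 - c) *
        ∑ k ∈ range m, (-1 : ZMod p) ^ k * (k : ZMod p) ^ (p - 1 - b) *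
          ∑ l ∈ range k, (l : ZMod p) ^ (p - 1 - a)) := by
  have hpos : Reduces p (sgn (a : ℤ)) 1 := by
    rw [sgn, if_neg (by omega)]
    exact Reduces.one
  have hneg (n : ℕ) (hn : 0 < n) : Reduces p (sgn (-(n : ℤ))) (-1) := by
    rw [sgn, if_pos (by omega)]
    exact Reduces.one.neg
  have h1 (k : ℕ) (hk : k < p) : Reduces p (Hrev [(a : ℤ)] (k - 1))
      (∑ l ∈ range k, (l : ZMod p) ^ (p - 1 - a)) := by
    simpa using reduces_Hrev_cons (s := (a : ℤ)) (t := []) (f := fun _ => 1) hk.le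
      (by simpa) (by simpa) hpos (fun _ _ => by simpa [Hrev] using Reduces.one)
  have h2 (m : ℕ) (hm : m < p) := reduces_Hrev_cons (s := -(b : ℤ)) hm.le
    (by simpa) (by simpa) (hneg b hb) h1
  have h3 := reduces_Hrev_cons (s := -(c : ℤ)) le_rfl (by simpa) (by simpa) (hneg c hc) h2
  simpa [H] using h3

lemma mul_double_sum_eq {β : ℕ → ZMod p}
    (hβ : ∀ i, i + 1 < p → Reduces p (bernoulli i) (β i)) {a b m : ℕ} (ha : 0 < a)
    (hab : a + b < p) (hb : 0 < b) :
    (a : ZMod p) * ∑ k ∈ range m, (-1 : ZMod p) ^ k * (k : ZMod p) ^ (p - 1 - b) *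
        ∑ l ∈ range k, (l : ZMod p) ^ (p - 1 - a) =
      -∑ i ∈ range (p - a), β i * ((p - a).choose i : ZMod p) *
        ∑ k ∈ range m, (-1 : ZMod p) ^ k * (k : ZMod p) ^ innerExponent p a b i := by
  have hpa : p - 1 - a + 1 = p - a := by omega
  have hcast : ((p - a : ℕ) : ZMod p) = -a := by
    rw [Nat.cast_sub (by omega)]
    simp
  have hinner (k : ℕ) : (a : ZMod p) * ∑ l ∈ range k, (l : ZMod p) ^ (p - 1 - a) =
      -∑ i ∈ range (p - a), β i * ((p - a).choose i : ZMod p) * (k : ZMod p) ^ (p - a - i) := by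
    have h := sum_range_pow_zmod hβ (r := p - 1 - a) (by omega) k
    rw [hpa, hcast] at h
    linear_combination -h
  have hexp (k i : ℕ) (hi : i < p - a) :
      (k : ZMod p) ^ (p - 1 - b) * (k : ZMod p) ^ (p - a - i) =
        (k : ZMod p) ^ innerExponent p a b i := by
    rw [← pow_add, innerExponent]
    split_ifs with h
    · rw [← pow_add_prime_sub_one (k : ZMod p) (show 0 < p - a - b - i by omega)]
      congr 1
      omega
    · congr 1
      omega
  simp only [mul_sum (range m)]
  rw [sum_comm, ← sum_neg_distrib]
  refine sum_congr rfl fun k _ => ?_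
  rw [mul_left_comm, hinner, mul_neg, mul_sum]
  congr 1
  refine sum_congr rfl fun i hi => ?_
  rw [← hexp k i (mem_range.mp hi)]
  ring

lemma mul_triple_sum_eq {β e : ℕ → ZMod p}
    (hβ : ∀ i, i + 1 < p → Reduces p (bernoulli i) (β i))
    (he : ∀ i, Reduces p (eulerZero i) (e i)) {a b c : ℕ} (ha : 0 < a) (hb : 0 < b)
    (hab : a + b < p) (hc : 0 < c) (hcp : c < p - 1) (hp : 2 < p) :
    2 * (a : ZMod p) * ∑ m ∈ range p, (-1 : ZMod p) ^ m * (m : ZMod p) ^ (p - 1 - c) *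
        ∑ k ∈ range m, (-1 : ZMod p) ^ k * (k : ZMod p) ^ (p - 1 - b) *
          ∑ l ∈ range k, (l : ZMod p) ^ (p - 1 - a) =
      -∑ i ∈ range (p - a), β i * ((p - a).choose i : ZMod p) *
        (e (innerExponent p a b i) * e (p - 1 - c) +
          ((innerExponent p a b i).choose c : ZMod p) * e (innerExponent p a b i - c)) := by
  have hlt (i : ℕ) : innerExponent p a b i < p := by
    rw [innerExponent]
    split_ifs <;> omega
  simp_rw [← two_mul_double_alternating_sum he hp (hlt _) hc hcp, mul_sum (range p)]
  rw [sum_comm, ← sum_neg_distrib]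
  refine sum_congr rfl fun m _ => ?_
  have h := mul_double_sum_eq hβ ha hab hb (m := m)
  have hswap : ∑ i ∈ range (p - a), β i * ((p - a).choose i : ZMod p) *
        (2 * ((-1 : ZMod p) ^ m * (m : ZMod p) ^ (p - 1 - c) *
          ∑ k ∈ range m, (-1 : ZMod p) ^ k * (k : ZMod p) ^ innerExponent p a b i)) =
      2 * ((-1 : ZMod p) ^ m * (m : ZMod p) ^ (p - 1 - c)) *
        ∑ i ∈ range (p - a), β i * ((p - a).choose i : ZMod p) *
          ∑ k ∈ range m, (-1 : ZMod p) ^ k * (k : ZMod p) ^ innerExponent p a b i := by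
    rw [mul_sum]
    exact sum_congr rfl fun i _ => by ring
  rw [hswap]
  linear_combination (2 * ((-1 : ZMod p) ^ m * (m : ZMod p) ^ (p - 1 - c))) * h

lemma residue_bernoulli_of_odd {β : ℕ → ZMod p}
    (hβ : ∀ i, i + 1 < p → Reduces p (bernoulli i) (β i)) {i : ℕ} (hi : i + 1 < p)
    (hodd : Odd i) (h1 : i ≠ 1) : β i = 0 := by
  have h := hβ i hi
  rw [bernoulli_eq_zero_of_odd hodd (by have := hodd.pos; omega)] at h
  exact h.unique Reduces.zero

lemma residue_eulerZero_of_even {e : ℕ → ZMod p} (he : ∀ i, Reduces p (eulerZero i) (e i))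
    {i : ℕ} (heven : Even i) (h0 : i ≠ 0) : e i = 0 := by
  have h := he i
  rw [eulerZero_of_even heven h0] at h
  exact h.unique Reduces.zero

lemma sum_product_terms {β e : ℕ → ZMod p}
    (hβ : ∀ i, i + 1 < p → Reduces p (bernoulli i) (β i))
    (he : ∀ i, Reduces p (eulerZero i) (e i)) {a b c : ℕ} (ha : 0 < a)
    (hc : 0 < c) (hw : Even (a + b + c)) (hpw : a + b + c + 3 ≤ p) :
    ∑ i ∈ range (p - a), β i * ((p - a).choose i : ZMod p) *
        (e (innerExponent p a b i) * e (p - 1 - c)) =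
      a / 2 * (e (p - a - b - 1) * e (p - c - 1)) := by
  have hp2 : (2 : ZMod p) ≠ 0 := two_zmod_ne_zero (by omega)
  have hodd : Odd p := (Fact.out : p.Prime).odd_of_ne_two (by omega)
  have hβ1 : β 1 = -1 / 2 := by
    have h := hβ 1 (by omega)
    rw [bernoulli_one] at h
    exact h.unique (Reduces.one.neg.div Reduces.two hp2)
  rw [sum_eq_single_of_mem 1 (mem_range.mpr (by omega))]
  · rw [hβ1, innerExponent, if_pos (by omega), Nat.choose_one_right, Nat.cast_sub (by omega),
      CharP.cast_eq_zero, Nat.sub_right_comm p 1 c]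
    field_simp
    ring
  · intro i hi hi1
    have hi' := mem_range.mp hi
    rcases Nat.even_or_odd i with hev | hod
    · by_cases hce : Even c
      · rw [residue_eulerZero_of_even he (i := p - 1 - c) (by grind) (by omega)]
        ring
      · rw [residue_eulerZero_of_even he (i := innerExponent p a b i)]
        · ring
        · rw [innerExponent]
          split_ifs <;> grind
        · rw [innerExponent]
          split_ifs <;> omega
    · rw [residue_bernoulli_of_odd hβ (by omega) hod hi1]
      ring

lemma sum_choose_terms {β e : ℕ → ZMod p}
    (hβ : ∀ i, i + 1 < p → Reduces p (bernoulli i) (β i))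
    {a b c : ℕ} (ha : 0 < a) (hc : 0 < c) (hw : Even (a + b + c)) (hpw : a + b + c + 3 ≤ p) :
    ∑ i ∈ range (p - a), β i * ((p - a).choose i : ZMod p) *
        (((innerExponent p a b i).choose c : ZMod p) * e (innerExponent p a b i - c)) =
      (∑ k ∈ Icc 2 (p - (a + b + c) + 1), ((p - a).choose (p - (a + b + c) + 1 - k) : ZMod p) *
          ((k + c - 1).choose c : ZMod p) * (e (k - 1) * β (p - (a + b + c) + 1 - k))) +
        ∑ k ∈ Icc (p + 1 - b - c) (p - c), ((p - a).choose (2 * p - (a + b + c) - k) : ZMod p) *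
          ((k + c - 1).choose c : ZMod p) * (e (k - 1) * β (2 * p - (a + b + c) - k)) := by
  have hodd : Odd p := (Fact.out : p.Prime).odd_of_ne_two (by omega)
  rw [← sum_range_add_sum_Ico _ (show p - a - b ≤ p - a by omega)]
  congr 1
  · rw [← sum_range_add_sum_Ico _ (show p - (a + b + c) ≤ p - a - b by omega),
      sum_eq_zero (s := Ico _ _), add_zero]
    · refine sum_bij' (fun i _ => p - (a + b + c) + 1 - i) (fun k _ => p - (a + b + c) + 1 - k)
        ?_ ?_ ?_ ?_ ?_
      · intro i hi
        rw [mem_range] at hi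
        rw [mem_Icc]
        omega
      · intro k hk
        rw [mem_Icc] at hk
        rw [mem_range]
        omega
      · intro i hi
        rw [mem_range] at hi
        omega
      · intro k hk
        rw [mem_Icc] at hk
        omega
      · intro i hi
        rw [mem_range] at hi
        rw [innerExponent, if_pos (by omega),
          show p - (a + b + c) + 1 - (p - (a + b + c) + 1 - i) = i by omega,
          show p - (a + b + c) + 1 - i + c - 1 = p - a - b - i by omega,
          show p - (a + b + c) + 1 - i - 1 = p - a - b - i - c by omega]
        ring
    · intro i hi
      rw [mem_Ico] at hi
      rcases hi.1.eq_or_lt with rfl | hlt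
      · rw [residue_bernoulli_of_odd hβ (by omega) (by grind) (by omega)]
        ring
      · rw [innerExponent, if_pos hi.2,
          Nat.choose_eq_zero_of_lt (show p - a - b - i < c by omega)]
        simp
  · refine sum_bij' (fun i _ => 2 * p - (a + b + c) - i) (fun k _ => 2 * p - (a + b + c) - k)
      ?_ ?_ ?_ ?_ ?_
    · intro i hi
      rw [mem_Ico] at hi
      rw [mem_Icc]
      omega
    · intro k hk
      rw [mem_Icc] at hk
      rw [mem_Ico]
      omega
    · intro i hi
      rw [mem_Ico] at hi
      omega
    · intro k hk
      rw [mem_Icc] at hk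
      omega
    · intro i hi
      rw [mem_Ico] at hi
      rw [innerExponent, if_neg (by omega),
        show 2 * p - (a + b + c) - (2 * p - (a + b + c) - i) = i by omega,
        show 2 * p - (a + b + c) - i + c - 1 = 2 * p - 1 - a - b - i by omega,
        show 2 * p - (a + b + c) - i - 1 = 2 * p - 1 - a - b - i - c by omega]
      ring

lemma eulerZero_pred {k : ℕ} (hk : 0 < k) :
    eulerZero (k - 1) = 2 * (1 - 2 ^ k) * bernoulli k / k := by
  obtain ⟨k, rfl⟩ := Nat.exists_eq_succ_of_ne_zero hk.ne'
  simp [eulerZero]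

lemma reduces_bernoulli_term {β e : ℕ → ZMod p}
    (hβ : ∀ i, i + 1 < p → Reduces p (bernoulli i) (β i))
    (he : ∀ i, Reduces p (eulerZero i) (e i)) {a k j : ℕ} (ha : 0 < a) (hap : a < p)
    (hp : 2 < p) (hk : 0 < k) (hj : j + 1 < p) (u v : ℕ) :
    Reduces p ((u : ℚ) * (v : ℚ) * ((1 - 2 ^ k) * bernoulli k * bernoulli j / ((a : ℚ) * k)))
      ((u : ZMod p) * (v : ZMod p) * (e (k - 1) * β j) / (2 * a)) := by
  have h := (((Reduces.natCast u).mul (Reduces.natCast v)).mul ((he (k - 1)).mul (hβ j hj))).div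
    (Reduces.two.mul (Reduces.natCast a))
    (mul_ne_zero (two_zmod_ne_zero hp) (natCast_zmod_ne_zero ha hap))
  convert! h using 1
  have ha' : (a : ℚ) ≠ 0 := by positivity
  have hk' : (k : ℚ) ≠ 0 := by positivity
  rw [eulerZero_pred hk]
  field_simp

lemma reduces_euler_product {e : ℕ → ZMod p} (he : ∀ i, Reduces p (eulerZero i) (e i))
    {m c : ℕ} (hm : 0 < m) (hmp : m < p) (hc : 0 < c) (hcp : c < p) (hp : 2 < p) :
    Reduces p ((1 - 2 ^ (p - c)) * (1 - 2 ^ (p - m)) * bernoulli (p - m) * bernoulli (p - c) /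
      ((m : ℚ) * c)) (e (p - m - 1) * e (p - c - 1) / 4) := by
  have hm0 := natCast_zmod_ne_zero hm hmp
  have hc0 := natCast_zmod_ne_zero hc hcp
  have h2 := two_zmod_ne_zero hp
  have h := ((((he (p - m - 1)).mul (he (p - c - 1))).mul
    ((Reduces.natCast (p - m)).mul (Reduces.natCast (p - c)))).div
    ((Reduces.two.pow 2).mul ((Reduces.natCast m).mul (Reduces.natCast c)))
    (mul_ne_zero (pow_ne_zero 2 h2) (mul_ne_zero hm0 hc0)))
  convert! h using 1
  · have hm' : (m : ℚ) ≠ 0 := by positivity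
    have hc' : (c : ℚ) ≠ 0 := by positivity
    have hpm : ((p - m : ℕ) : ℚ) ≠ 0 := by exact_mod_cast (Nat.sub_pos_of_lt hmp).ne'
    have hpc : ((p - c : ℕ) : ℚ) ≠ 0 := by exact_mod_cast (Nat.sub_pos_of_lt hcp).ne'
    rw [eulerZero_pred (Nat.sub_pos_of_lt hmp), eulerZero_pred (Nat.sub_pos_of_lt hcp)]
    field_simp
  · rw [Nat.cast_sub hmp.le, Nat.cast_sub hcp.le, CharP.cast_eq_zero,
      show (4 : ZMod p) = 2 ^ 2 by norm_num]
    field_simp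
    ring

end

/-- Even weight, depth three: explicit congruence for `H(a,-b,-c)`. -/
theorem depth_three_even_weight (a b c : ℕ) (ha : 0 < a) (hb : 0 < b) (hc : 0 < c)
    (hw : Even (a + b + c)) (p : ℕ) (hp : p.Prime) (hpw : a + b + c + 3 ≤ p) :
    pcong p (H [(a : ℤ), -(b : ℤ), -(c : ℤ)] (p - 1))
      (-(∑ k ∈ Finset.Icc 2 (p - (a + b + c) + 1),
          (Nat.choose (p - a) (p - (a + b + c) + 1 - k) : ℚ) *
            (Nat.choose (k + c - 1) c : ℚ) *
            ((1 - 2 ^ k) * bernoulli k * bernoulli (p - (a + b + c) + 1 - k) /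
              ((a : ℚ) * k))) -
        (∑ k ∈ Finset.Icc (p + 1 - b - c) (p - c),
          (Nat.choose (p - a) (2 * p - (a + b + c) - k) : ℚ) *
            (Nat.choose (k + c - 1) c : ℚ) *
            ((1 - 2 ^ k) * bernoulli k * bernoulli (2 * p - (a + b + c) - k) /
              ((a : ℚ) * k))) -
        (1 - 2 ^ (p - c)) * (1 - 2 ^ (p - a - b)) * bernoulli (p - a - b) * bernoulli (p - c) /
          (((a : ℚ) + b) * c)) := by

  have : Fact p.Prime := ⟨hp⟩
  have hp2 : 2 < p := by omega
  have h2 : (2 : ZMod p) ≠ 0 := two_zmod_ne_zero hp2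
  have ha0 : (a : ZMod p) ≠ 0 := natCast_zmod_ne_zero ha (by omega)
  choose! β hβ using exists_reduces_bernoulli (p := p)
  choose e he using exists_reduces_eulerZero hp2
  have hH := reduces_H (p := p) a b c ha hb hc (by omega) (by omega) (by omega)
  have hsum := mul_triple_sum_eq hβ he ha hb (show a + b < p by omega) hc (by omega) hp2
  simp only [mul_add] at hsum
  rw [sum_add_distrib, sum_product_terms hβ he ha hc hw hpw,
    sum_choose_terms hβ ha hc hw hpw] at hsum
  have hfirst := Reduces.sum (p := p) (Icc 2 (p - (a + b + c) + 1)) fun k hk =>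
    have hk' := mem_Icc.mp hk
    reduces_bernoulli_term hβ he ha (by omega) hp2 (show 0 < k by omega)
      (show p - (a + b + c) + 1 - k + 1 < p by omega)
      ((p - a).choose (p - (a + b + c) + 1 - k)) ((k + c - 1).choose c)
  have hsecond := Reduces.sum (p := p) (Icc (p + 1 - b - c) (p - c)) fun k hk =>
    have hk' := mem_Icc.mp hk
    reduces_bernoulli_term hβ he ha (by omega) hp2 (show 0 < k by omega)
      (show 2 * p - (a + b + c) - k + 1 < p by omega)
      ((p - a).choose (2 * p - (a + b + c) - k)) ((k + c - 1).choose c)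
  have hthird := reduces_euler_product he (show 0 < a + b by omega) (show a + b < p by omega)
    hc (show c < p by omega) hp2
  rw [Nat.cast_add, ← Nat.sub_sub] at hthird
  refine hH.pcong ?_
  convert! (hfirst.neg.sub hsecond).sub hthird using 1
  rw [← sum_div, ← sum_div]
  apply mul_left_cancel₀ (mul_ne_zero h2 ha0)
  rw [hsum, show (4 : ZMod p) = 2 ^ 2 by norm_num]
  field_simp
  ring
end

section
/- For every prime p \ge 5, one has H(-1;p-1) \equiv -2q_p + p q_p^2 - \frac{2}{3} p^2 q_p^3 - \frac{1}{4} p^2 B_{p-3} \pmod{p^3}. -/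
open Finset

/-- The subring of `ℚ` of fractions whose denominator can be chosen coprime to `p`. -/
def coprimeDenSubring (p : ℕ) : Subring ℚ where
  carrier := {x | ∃ b : ℕ, b.Coprime p ∧ ∃ a : ℤ, x * b = a}
  mul_mem' := by
    rintro x y ⟨b, hb, a, h⟩ ⟨d, hd, c, h'⟩
    refine ⟨b * d, hb.mul_left hd, a * c, ?_⟩
    push_cast
    linear_combination (y * d) * h + a * h'
  one_mem' := ⟨1, by simp, 1, by simp⟩
  add_mem' := by
    rintro x y ⟨b, hb, a, h⟩ ⟨d, hd, c, h'⟩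
    refine ⟨b * d, hb.mul_left hd, a * d + c * b, ?_⟩
    push_cast
    linear_combination d * h + b * h'
  zero_mem' := ⟨1, by simp, 0, by simp⟩
  neg_mem' := by
    rintro x ⟨b, hb, a, h⟩
    refine ⟨b, hb, -a, ?_⟩
    push_cast
    linear_combination -h

lemma inv_natCast_mem_coprimeDenSubring {p n : ℕ} (h : n.Coprime p) :
    (n : ℚ)⁻¹ ∈ coprimeDenSubring p := by
  by_cases hn : n = 0
  · simp [hn, zero_mem]
  · exact ⟨n, h, 1, by field_simp; simp⟩

lemma coprime_of_pos_of_lt {p n : ℕ} (hp : p.Prime) (h0 : 0 < n) (h : n < p) : n.Coprime p :=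
  (Nat.coprime_of_lt_prime h0.ne' h hp).symm

lemma pow_dvd_num_of_eq_mul {p n : ℕ} {x z : ℚ} (hz : z ∈ coprimeDenSubring p)
    (hx : x = (p : ℚ) ^ n * z) : ((p ^ n : ℕ) : ℤ) ∣ x.num := by
  obtain ⟨b, hb, a, h⟩ := hz
  have key : x.num * b = (p ^ n : ℕ) * (a * x.den) := by
    have h1 := Rat.num_div_den x
    have h2 : (x.den : ℚ) ≠ 0 := by exact_mod_cast x.den_nz
    have h3 : (x.num : ℚ) = x * x.den := by
      field_simp at h1
      linear_combination h1
    have : (x.num : ℚ) * b = (p ^ n : ℕ) * (a * x.den) := by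
      rw [h3, ← h]
      push_cast
      rw [hx]
      ring
    exact_mod_cast this
  refine IsCoprime.dvd_of_dvd_mul_right ?_ (Dvd.intro _ key.symm)
  exact Nat.isCoprime_iff_coprime.mpr (Nat.Coprime.pow_left n hb.symm)

lemma bernoulli_mem_coprimeDenSubring {p : ℕ} (hp : p.Prime) (n : ℕ) (hn : n + 1 < p) :
    bernoulli n ∈ coprimeDenSubring p := by
  have key : ∀ n : ℕ, n + 1 < p → bernoulli' n ∈ coprimeDenSubring p := by
    intro n
    induction n using Nat.strong_induction_on with
    | _ n ih =>
      intro hn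
      rw [bernoulli'_def]
      refine sub_mem (one_mem _) (sum_mem fun k hk => ?_)
      have hk' := Finset.mem_range.mp hk
      refine mul_mem ?_ (ih k hk' (by omega))
      rw [div_eq_mul_inv]
      refine mul_mem (natCast_mem _ _) ?_
      have := inv_natCast_mem_coprimeDenSubring
        (coprime_of_pos_of_lt hp (n := n - k + 1) (by omega) (by omega))
      rwa [Nat.cast_add, Nat.cast_sub hk'.le, Nat.cast_one] at this
  rw [bernoulli]
  exact mul_mem (pow_mem (neg_mem (one_mem _)) _) (key n hn)

@[to_additive]
lemma prod_Icc_double_eq_prod_reflect {M : Type*} [CommMonoid M] (f : ℕ → M) (m : ℕ) :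
    ∏ k ∈ Icc 1 (2 * m), f k = ∏ j ∈ Icc 1 m, (f j * f (2 * m + 1 - j)) := by
  rw [Finset.prod_mul_distrib]
  have h : ∏ j ∈ Icc 1 m, f (2 * m + 1 - j) = ∏ j ∈ Icc (m + 1) (2 * m), f j := by
    refine Finset.prod_bij' (fun j _ => 2 * m + 1 - j) (fun j _ => 2 * m + 1 - j) ?_ ?_ ?_ ?_ ?_
    all_goals
      intro j hj
      simp only [Finset.mem_Icc] at hj ⊢
    · omega
    · omega
    · omega
    · omega
  rw [h, ← Finset.prod_union]
  · congr 1
    ext j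
    simp only [Finset.mem_union, Finset.mem_Icc]
    omega
  · rw [Finset.disjoint_left]
    intro j
    simp only [Finset.mem_Icc]
    omega

@[to_additive]
lemma prod_Icc_double_eq_prod_even_reflect {M : Type*} [CommMonoid M] (f : ℕ → M) (m : ℕ) :
    ∏ k ∈ Icc 1 (2 * m), f k = ∏ j ∈ Icc 1 m, (f (2 * j) * f (2 * m + 1 - 2 * j)) := by
  have h1 : ∏ k ∈ Icc 1 (2 * m), f k = ∏ j ∈ Icc 1 m, (f (2 * j) * f (2 * j - 1)) := by
    induction m with
    | zero => simp
    | succ m ih =>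
      rw [Finset.prod_Icc_succ_top (by omega), ← ih, show 2 * (m + 1) = 2 * m + 1 + 1 by ring,
        Finset.prod_Icc_succ_top (by omega), Finset.prod_Icc_succ_top (by omega), mul_assoc,
        mul_comm (f (2 * m + 1))]
      rfl
  rw [h1, Finset.prod_mul_distrib, Finset.prod_mul_distrib]
  congr 1
  refine Finset.prod_bij' (fun j _ => m + 1 - j) (fun j _ => m + 1 - j) ?_ ?_ ?_ ?_ ?_
  all_goals
    intro j hj
    simp only [Finset.mem_Icc] at hj ⊢
  · omega
  · omega
  · omega
  · omega
  · congr 1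
    omega

/-- The logarithm `log (1 + p u) / p`, truncated after the cubic term. -/
def truncLog (p u : ℚ) : ℚ := u - p * u ^ 2 / 2 + p ^ 2 * u ^ 3 / 3

lemma truncLog_mul {p : ℕ} {u v : ℚ} (h6 : Nat.Coprime 6 p) (hu : u ∈ coprimeDenSubring p)
    (hv : v ∈ coprimeDenSubring p) :
    ∃ r ∈ coprimeDenSubring p,
      truncLog p (u + v + p * u * v) = truncLog p u + truncLog p v + p ^ 3 * r := by
  refine ⟨((6 : ℕ) : ℚ)⁻¹ * ((-3 : ℤ) * (u * v) ^ 2 + (6 : ℕ) * (u + v) ^ 2 * (u * v)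
      + (6 : ℕ) * p * (u + v) * (u * v) ^ 2 + (2 : ℕ) * p ^ 2 * (u * v) ^ 3), ?_, ?_⟩
  · have h := inv_natCast_mem_coprimeDenSubring h6
    have hp := natCast_mem (coprimeDenSubring p) p
    have hs := add_mem hu hv
    have hw := mul_mem hu hv
    have h2 := natCast_mem (coprimeDenSubring p) 2
    have h6' := natCast_mem (coprimeDenSubring p) 6
    refine mul_mem h (add_mem (add_mem (add_mem ?_ ?_) ?_) ?_)
    · exact mul_mem (intCast_mem _ _) (pow_mem hw _)
    · exact mul_mem (mul_mem h6' (pow_mem hs _)) hw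
    · exact mul_mem (mul_mem (mul_mem h6' hp) hs) (pow_mem hw _)
    · exact mul_mem (mul_mem h2 (pow_mem hp _)) (pow_mem hw _)
  · unfold truncLog
    push_cast
    ring

lemma exists_prod_one_add_mul {p : ℕ} (h6 : Nat.Coprime 6 p) {ι : Type*} (s : Finset ι)
    (a : ι → ℚ) (ha : ∀ i ∈ s, a i ∈ coprimeDenSubring p) :
    ∃ u ∈ coprimeDenSubring p, ∃ r ∈ coprimeDenSubring p,
      ∏ i ∈ s, (1 + p * a i) = 1 + p * u ∧
      truncLog p u = ∑ i ∈ s, truncLog p (a i) + p ^ 3 * r := by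
  classical
  induction s using Finset.induction_on with
  | empty => exact ⟨0, zero_mem _, 0, zero_mem _, by simp, by simp [truncLog]⟩
  | insert i s hi ih =>
    obtain ⟨u, hu, r, hr, h1, h2⟩ := ih fun j hj => ha j (Finset.mem_insert_of_mem hj)
    have hai := ha i (Finset.mem_insert_self i s)
    obtain ⟨r', hr', h3⟩ := truncLog_mul h6 hai hu
    refine ⟨a i + u + p * a i * u, ?_, r + r', add_mem hr hr', ?_, ?_⟩
    · exact add_mem (add_mem hai hu) (mul_mem (mul_mem (natCast_mem _ _) hai) hu)
    · rw [Finset.prod_insert hi, h1]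
      ring
    · rw [Finset.sum_insert hi, h3, h2]
      ring

/-- The sum of inverse `e`-th powers of `1, …, m`. -/
def invPowSum (e m : ℕ) : ℚ := ∑ j ∈ Icc 1 m, ((j : ℚ)⁻¹) ^ e

section

variable {p m : ℕ}

lemma inv_mem_of_mem_Icc (hp : p.Prime) (hm : p = 2 * m + 1) {j : ℕ} (hj : j ∈ Icc 1 (2 * m)) :
    (j : ℚ)⁻¹ ∈ coprimeDenSubring p := by
  rw [Finset.mem_Icc] at hj
  exact inv_natCast_mem_coprimeDenSubring (coprime_of_pos_of_lt hp (by omega) (by omega))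

lemma inv_reflect_eq (hm : p = 2 * m + 1) {j : ℕ} (hj : j ∈ Icc 1 (2 * m)) :
    ((2 * m + 1 - j : ℕ) : ℚ)⁻¹ = -(j : ℚ)⁻¹ + p * (j : ℚ)⁻¹ * ((2 * m + 1 - j : ℕ) : ℚ)⁻¹ := by
  rw [Finset.mem_Icc] at hj
  have h1 : (j : ℚ) ≠ 0 := by exact_mod_cast (by omega : j ≠ 0)
  have h2 : ((2 * m + 1 - j : ℕ) : ℚ) ≠ 0 := by exact_mod_cast (by omega : 2 * m + 1 - j ≠ 0)
  have h3 : ((2 * m + 1 - j : ℕ) : ℚ) = p - j := by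
    rw [Nat.cast_sub (by omega), hm]
  field_simp
  rw [h3]
  ring

lemma reflect_mem_Icc {j : ℕ} (hj : j ∈ Icc 1 (2 * m)) : 2 * m + 1 - j ∈ Icc 1 (2 * m) := by
  rw [Finset.mem_Icc] at hj ⊢
  omega

lemma invPowSum_one_two_mul (hp : p.Prime) (hm : p = 2 * m + 1) :
    ∃ r ∈ coprimeDenSubring p,
      invPowSum 1 (2 * m) = -p * invPowSum 2 m - p ^ 2 * invPowSum 3 m + p ^ 3 * r := by
  refine ⟨∑ j ∈ Icc 1 m, ((j : ℚ)⁻¹) ^ 3 * ((2 * m + 1 - j : ℕ) : ℚ)⁻¹, sum_mem fun j hj => ?_, ?_⟩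
  · have hj' : j ∈ Icc 1 (2 * m) := by
      rw [Finset.mem_Icc] at hj ⊢
      omega
    exact mul_mem (pow_mem (inv_mem_of_mem_Icc hp hm hj') _)
      (inv_mem_of_mem_Icc hp hm (reflect_mem_Icc hj'))
  · unfold invPowSum
    rw [sum_Icc_double_eq_sum_reflect, Finset.mul_sum, Finset.mul_sum, Finset.mul_sum,
      ← Finset.sum_sub_distrib, ← Finset.sum_add_distrib]
    refine Finset.sum_congr rfl fun j hj => ?_
    have h := inv_reflect_eq hm (j := j) (by
      rw [Finset.mem_Icc] at hj ⊢
      omega)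
    generalize ((2 * m + 1 - j : ℕ) : ℚ)⁻¹ = y at *
    generalize (j : ℚ)⁻¹ = x at *
    linear_combination (1 + p * x + p ^ 2 * x ^ 2) * h

lemma inv_sq_add_inv_sq_reflect (hp : p.Prime) (hm : p = 2 * m + 1) {j : ℕ}
    (hj : j ∈ Icc 1 (2 * m)) :
    ∃ r ∈ coprimeDenSubring p, ((j : ℚ)⁻¹) ^ 2 + (((2 * m + 1 - j : ℕ) : ℚ)⁻¹) ^ 2 =
      2 * ((j : ℚ)⁻¹) ^ 2 + 2 * p * ((j : ℚ)⁻¹) ^ 3 + p ^ 2 * r := by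
  have h := inv_reflect_eq hm hj
  have hx := inv_mem_of_mem_Icc hp hm hj
  have hy := inv_mem_of_mem_Icc hp hm (reflect_mem_Icc hj)
  generalize ((2 * m + 1 - j : ℕ) : ℚ)⁻¹ = y at *
  generalize (j : ℚ)⁻¹ = x at *
  refine ⟨x ^ 2 * y ^ 2 + (-2 : ℤ) * x ^ 3 * y, ?_, ?_⟩
  · exact add_mem (mul_mem (pow_mem hx _) (pow_mem hy _))
      (mul_mem (mul_mem (intCast_mem _ _) (pow_mem hx _)) hy)
  · push_cast
    linear_combination (y + (-x + p * x * y) - 2 * p * x ^ 2) * h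

lemma exists_sum_eq {ι : Type*} (s : Finset ι) (R : Subring ℚ) (f g : ι → ℚ) (c : ℚ)
    (h : ∀ i ∈ s, ∃ r ∈ R, f i = g i + c * r) :
    ∃ r ∈ R, ∑ i ∈ s, f i = ∑ i ∈ s, g i + c * r := by
  choose! r hr h using h
  refine ⟨∑ i ∈ s, r i, sum_mem hr, ?_⟩
  rw [Finset.mul_sum, ← Finset.sum_add_distrib]
  exact Finset.sum_congr rfl h

lemma invPowSum_two_eq (hp : p.Prime) (hm : p = 2 * m + 1) :
    ∃ r ∈ coprimeDenSubring p,
      6 * invPowSum 2 m = -7 * p * invPowSum 3 m + p ^ 2 * r := by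
  obtain ⟨r, hr, h⟩ := exists_sum_eq (Icc 1 m) (coprimeDenSubring p) _ _ _ fun j hj =>
    inv_sq_add_inv_sq_reflect hp hm (j := j) (by
      rw [Finset.mem_Icc] at hj ⊢
      omega)
  obtain ⟨r', hr', h'⟩ := exists_sum_eq (Icc 1 m) (coprimeDenSubring p) _ _ _ fun j hj =>
    inv_sq_add_inv_sq_reflect hp hm (j := 2 * j) (by
      rw [Finset.mem_Icc] at hj ⊢
      omega)
  have e1 := sum_Icc_double_eq_sum_reflect (fun k : ℕ => ((k : ℚ)⁻¹) ^ 2) m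
  have e2 := sum_Icc_double_eq_sum_even_reflect (fun k : ℕ => ((k : ℚ)⁻¹) ^ 2) m
  refine ⟨(4 : ℕ) * (r' - r), mul_mem (natCast_mem _ _) (sub_mem hr' hr), ?_⟩
  have e := e1.symm.trans e2
  rw [h, h'] at e
  simp only [Nat.cast_mul, mul_inv, mul_pow, Finset.sum_add_distrib, ← Finset.mul_sum] at e
  unfold invPowSum
  push_cast at e ⊢
  linear_combination 4 * e

lemma prod_one_sub_eq (hm : p = 2 * m + 1) :
    ∏ j ∈ Icc 1 m, (1 + (p : ℚ) * -(j : ℚ)⁻¹) =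
      2 ^ (p - 1) * ∏ j ∈ Icc 1 m, (1 + (p : ℚ) * (-(2 : ℚ)⁻¹ * (j : ℚ)⁻¹)) := by
  have e := (prod_Icc_double_eq_prod_reflect (fun k : ℕ => (k : ℚ)) m).symm.trans
    (prod_Icc_double_eq_prod_even_reflect (fun k : ℕ => (k : ℚ)) m)
  have hne : ∏ j ∈ Icc 1 m, (-(j : ℚ) ^ 2) ≠ 0 := by
    refine Finset.prod_ne_zero_iff.mpr fun j hj => ?_
    rw [Finset.mem_Icc] at hj
    have h1 : (j : ℚ) ≠ 0 := by exact_mod_cast (by omega : j ≠ 0)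
    simpa using h1
  have h4 : (2 : ℚ) ^ (p - 1) = ∏ j ∈ Icc 1 m, (4 : ℚ) := by
    rw [Finset.prod_const, Nat.card_Icc, hm, Nat.add_sub_cancel, Nat.add_sub_cancel, pow_mul]
    norm_num
  refine mul_left_cancel₀ hne ?_
  rw [h4, ← Finset.prod_mul_distrib, ← Finset.prod_mul_distrib, ← Finset.prod_mul_distrib]
  refine Eq.trans (Finset.prod_congr rfl fun j hj => ?_)
    (e.trans (Finset.prod_congr rfl fun j hj => ?_))
  all_goals
    rw [Finset.mem_Icc] at hj
    have h1 : (j : ℚ) ≠ 0 := by exact_mod_cast (by omega : j ≠ 0)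
    rw [Nat.cast_sub (by omega), hm]
    push_cast
    field_simp
    ring

lemma sum_truncLog (a : ℚ) :
    ∑ j ∈ Icc 1 m, truncLog p (a * (j : ℚ)⁻¹) =
      a * invPowSum 1 m - p * a ^ 2 / 2 * invPowSum 2 m + p ^ 2 * a ^ 3 / 3 * invPowSum 3 m := by
  unfold invPowSum truncLog
  rw [Finset.mul_sum, Finset.mul_sum, Finset.mul_sum, ← Finset.sum_sub_distrib,
    ← Finset.sum_add_distrib]
  refine Finset.sum_congr rfl fun j _ => ?_
  ring

lemma coprime_six (hp : p.Prime) (hp5 : 5 ≤ p) : Nat.Coprime 6 p := by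
  have h2 := coprime_of_pos_of_lt hp (n := 2) (by omega) (by omega)
  have h3 := coprime_of_pos_of_lt hp (n := 3) (by omega) (by omega)
  exact Nat.Coprime.mul_left h2 h3

lemma qp_mem (hp : p.Prime) (hp5 : 5 ≤ p) : qp p ∈ coprimeDenSubring p := by
  have h2 := coprime_of_pos_of_lt hp (n := 2) (by omega) (by omega)
  have h := Nat.ModEq.pow_totient h2
  rw [Nat.totient_prime hp] at h
  obtain ⟨c, hc⟩ := (Nat.modEq_iff_dvd.mp h.symm)
  have hp0 : (p : ℚ) ≠ 0 := by exact_mod_cast hp.ne_zero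
  refine ⟨1, by simp, c, ?_⟩
  have hc' : (2 : ℚ) ^ (p - 1) - 1 = p * c := by exact_mod_cast hc
  rw [qp, hc']
  field_simp
  simp

lemma invPowSum_one_eq (hp : p.Prime) (hp5 : 5 ≤ p) (hm : p = 2 * m + 1) :
    ∃ r ∈ coprimeDenSubring p, invPowSum 1 m =
      -2 * truncLog p (qp p) - 3 / 4 * p * invPowSum 2 m - 7 / 12 * p ^ 2 * invPowSum 3 m
        + p ^ 3 * r := by
  have h6 := coprime_six hp hp5
  have hj : ∀ j ∈ Icc 1 m, (j : ℚ)⁻¹ ∈ coprimeDenSubring p := fun j hj =>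
    inv_mem_of_mem_Icc hp hm (by
      rw [Finset.mem_Icc] at hj ⊢
      omega)
  have h2 := inv_natCast_mem_coprimeDenSubring
    (coprime_of_pos_of_lt hp (n := 2) (by omega) (by omega))
  obtain ⟨u, hu, r, hr, e1, e2⟩ := exists_prod_one_add_mul h6 (Icc 1 m)
    (fun j => (-1 : ℚ) * (j : ℚ)⁻¹) fun j hj' => mul_mem (neg_mem (one_mem _)) (hj j hj')
  obtain ⟨v, hv, r', hr', e1', e2'⟩ := exists_prod_one_add_mul h6 (Icc 1 m)
    (fun j => -(2 : ℚ)⁻¹ * (j : ℚ)⁻¹) fun j hj' => mul_mem (neg_mem h2) (hj j hj')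
  obtain ⟨r'', hr'', e3⟩ := truncLog_mul h6 (qp_mem hp hp5) hv
  have hp0 : (p : ℚ) ≠ 0 := by exact_mod_cast hp.ne_zero
  have hq : (2 : ℚ) ^ (p - 1) = 1 + p * qp p := by
    rw [qp]
    field_simp
    ring
  have huv : u = qp p + v + p * qp p * v := by
    have h := prod_one_sub_eq hm
    simp only [neg_one_mul] at e1
    rw [e1, e1', hq] at h
    refine mul_left_cancel₀ hp0 ?_
    linear_combination h
  rw [← huv, e2, e2'] at e3
  rw [sum_truncLog, sum_truncLog] at e3
  refine ⟨(2 : ℕ) * (r - r' - r''), mul_mem (natCast_mem _ _) (sub_mem (sub_mem hr hr') hr''), ?_⟩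
  push_cast
  linear_combination -2 * e3

lemma H_neg_one_eq (hm : p = 2 * m + 1) :
    H [-1] (p - 1) = invPowSum 1 m - invPowSum 1 (2 * m) := by
  have h : H [-1] (p - 1) = ∑ k ∈ Icc 1 (2 * m), (-1 : ℚ) ^ k * (k : ℚ)⁻¹ := by
    rw [hm, Nat.add_sub_cancel]
    simp [H, Hrev, sgn, div_eq_mul_inv]
  rw [h, invPowSum, invPowSum, sum_Icc_double_eq_sum_even_reflect,
    sum_Icc_double_eq_sum_even_reflect, ← Finset.sum_sub_distrib]
  refine Finset.sum_congr rfl fun j hj => ?_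
  rw [Finset.mem_Icc] at hj
  have h1 : (-1 : ℚ) ^ (2 * j) = 1 := Even.neg_one_pow (by simp)
  have h2 : (-1 : ℚ) ^ (2 * m + 1 - 2 * j) = -1 := Odd.neg_one_pow ⟨m - j, by omega⟩
  rw [h1, h2]
  push_cast
  rw [mul_inv]
  ring

lemma sum_pow_eq_mul_bernoulli (hp : p.Prime) (k : ℕ) (hk : k + 2 < p) :
    ∃ r ∈ coprimeDenSubring p,
      ∑ j ∈ range p, (j : ℚ) ^ k = p * bernoulli k + p ^ 2 * r := by
  rw [sum_range_pow, Finset.sum_range_succ]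
  have hk1 : ((k + 1 : ℕ) : ℚ)⁻¹ ∈ coprimeDenSubring p :=
    inv_natCast_mem_coprimeDenSubring (coprime_of_pos_of_lt hp (by omega) (by omega))
  refine ⟨∑ i ∈ range k, bernoulli i * ((k + 1).choose i) * (p : ℚ) ^ (k - 1 - i)
    * ((k + 1 : ℕ) : ℚ)⁻¹, sum_mem fun i hi => ?_, ?_⟩
  · rw [Finset.mem_range] at hi
    exact mul_mem (mul_mem (mul_mem (bernoulli_mem_coprimeDenSubring hp i (by omega))
      (natCast_mem _ _)) (pow_mem (natCast_mem _ _) _)) hk1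
  · rw [Finset.mul_sum, add_comm]
    congr 1
    · have h : ((k : ℚ) + 1) ≠ 0 := by positivity
      rw [Nat.add_sub_cancel_left, Nat.choose_succ_self_right]
      push_cast
      field_simp
    · refine Finset.sum_congr rfl fun i hi => ?_
      rw [Finset.mem_range] at hi
      rw [show k + 1 - i = k - 1 - i + 2 by omega, pow_add]
      push_cast
      ring

lemma pow_add_pow_reflect (hm : p = 2 * m + 1) {k : ℕ} (hk : Even k) {j : ℕ}
    (hj : j ∈ Icc 1 (2 * m)) :
    ∃ r ∈ coprimeDenSubring p, (j : ℚ) ^ k + ((2 * m + 1 - j : ℕ) : ℚ) ^ k =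
      2 * (j : ℚ) ^ k - k * p * (j : ℚ) ^ (k - 1) + p ^ 2 * r := by
  rw [Finset.mem_Icc] at hj
  obtain ⟨c, hc⟩ := Polynomial.powAddExpansion (j : ℤ) (-p) k
  refine ⟨c, intCast_mem _ _, ?_⟩
  have h : (((2 * m + 1 - j : ℕ) : ℤ)) ^ k = ((j : ℤ) + -p) ^ k := by
    rw [← hk.neg_pow, hm, Nat.cast_sub (by omega)]
    congr 1
    ring
  rw [hc] at h
  have h' : ((2 * m + 1 - j : ℕ) : ℚ) ^ k =
      (j : ℚ) ^ k + k * (j : ℚ) ^ (k - 1) * (-p) + c * (-p) ^ 2 := by exact_mod_cast h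
  rw [h']
  ring

lemma pow_eq_inv_pow (hp : p.Prime) (hp5 : 5 ≤ p) (hm : p = 2 * m + 1) {j : ℕ}
    (hj : j ∈ Icc 1 (2 * m)) :
    ∃ r ∈ coprimeDenSubring p, (j : ℚ) ^ (p - 4) = ((j : ℚ)⁻¹) ^ 3 + p * r := by
  have hx := inv_mem_of_mem_Icc hp hm hj
  rw [Finset.mem_Icc] at hj
  have h := Nat.ModEq.pow_totient (coprime_of_pos_of_lt hp (n := j) (by omega) (by omega))
  rw [Nat.totient_prime hp] at h
  obtain ⟨c, hc⟩ := (Nat.modEq_iff_dvd.mp h.symm)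
  have hc' : (j : ℚ) ^ (p - 1) - 1 = p * c := by exact_mod_cast hc
  rw [show p - 1 = p - 4 + 3 by omega, pow_add] at hc'
  have h1 : (j : ℚ) ≠ 0 := by exact_mod_cast (by omega : j ≠ 0)
  refine ⟨c * ((j : ℚ)⁻¹) ^ 3, mul_mem (intCast_mem _ _) (pow_mem hx _), ?_⟩
  field_simp
  linear_combination hc'

lemma invPowSum_three_eq (hp : p.Prime) (hp5 : 5 ≤ p) (hm : p = 2 * m + 1) :
    ∃ r ∈ coprimeDenSubring p, invPowSum 3 m = -2 * bernoulli (p - 3) + p * r := by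
  have hk : Even (p - 3) := ⟨m - 1, by omega⟩
  have hk1 : p - 3 - 1 = p - 4 := by omega
  have hsub : ∀ j ∈ Icc 1 m, j ∈ Icc 1 (2 * m) ∧ 2 * j ∈ Icc 1 (2 * m) := by
    intro j hj
    simp only [Finset.mem_Icc] at hj ⊢
    omega
  obtain ⟨r1, hr1, h1⟩ := exists_sum_eq (Icc 1 m) (coprimeDenSubring p) _ _ _ fun j hj =>
    pow_add_pow_reflect hm hk (hsub j hj).1
  obtain ⟨r2, hr2, h2⟩ := exists_sum_eq (Icc 1 m) (coprimeDenSubring p) _ _ _ fun j hj =>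
    pow_add_pow_reflect hm hk (hsub j hj).2
  obtain ⟨r3, hr3, h3⟩ := sum_pow_eq_mul_bernoulli hp (p - 3) (by omega)
  obtain ⟨r4, hr4, h4⟩ := exists_sum_eq (Icc 1 m) (coprimeDenSubring p) _ _ _ fun j hj =>
    pow_eq_inv_pow hp hp5 hm (hsub j hj).1
  have e1 := sum_Icc_double_eq_sum_reflect (fun j : ℕ => (j : ℚ) ^ (p - 3)) m
  have e2 := sum_Icc_double_eq_sum_even_reflect (fun j : ℕ => (j : ℚ) ^ (p - 3)) m
  have hT : ∑ j ∈ range p, (j : ℚ) ^ (p - 3) = ∑ j ∈ Icc 1 (2 * m), (j : ℚ) ^ (p - 3) := by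
    rw [Finset.range_eq_Ico, Finset.sum_eq_sum_Ico_succ_bot hp.pos]
    have h0 : p - 3 ≠ 0 := by omega
    rw [Nat.cast_zero, zero_pow h0, zero_add]
    congr 1
    ext j
    simp only [Finset.mem_Ico, Finset.mem_Icc]
    omega
  have hp0 : (p : ℚ) ≠ 0 := by exact_mod_cast hp.ne_zero
  have hq : (2 : ℚ) ^ (p - 1) = 1 + p * qp p := by
    rw [qp]
    field_simp
    ring
  have hq3 : (2 : ℚ) ^ (p - 3) = (1 + p * qp p) / 4 := by
    rw [← hq, show p - 1 = p - 3 + 2 by omega, pow_add]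
    ring
  have hq4 : (2 : ℚ) ^ (p - 4) = (1 + p * qp p) / 8 := by
    rw [← hq, show p - 1 = p - 4 + 3 by omega, pow_add]
    ring
  rw [← e1, ← hT, h3] at h1
  rw [← e2, ← hT, h3] at h2
  rw [hk1] at h1 h2
  have hc : ((p - 3 : ℕ) : ℚ) = p - 3 := by
    rw [Nat.cast_sub (by omega)]
    simp
  simp only [Nat.cast_mul, mul_pow, Nat.cast_ofNat, Finset.sum_sub_distrib, ← Finset.mul_sum,
    hc, hq3, hq4] at h1 h2
  rw [h4] at h1 h2
  have hC : invPowSum 3 m ∈ coprimeDenSubring p :=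
    sum_mem fun j hj => pow_mem (inv_mem_of_mem_Icc hp hm (hsub j hj).1) _
  change _ = _ - _ * (invPowSum 3 m + _) + _ at h1
  change _ = _ - _ * (_ * (invPowSum 3 m + _)) + _ at h2
  have hB := bernoulli_mem_coprimeDenSubring hp (p - 3) (by omega)
  have hqp := qp_mem hp hp5
  have hi3 := inv_natCast_mem_coprimeDenSubring
    (coprime_of_pos_of_lt hp (n := 3) (by omega) (by omega))
  lift qp p to coprimeDenSubring p using hqp with q
  lift bernoulli (p - 3) to coprimeDenSubring p using hB with B
  lift invPowSum 3 m to coprimeDenSubring p using hC with C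
  lift r1 to coprimeDenSubring p using hr1
  lift r2 to coprimeDenSubring p using hr2
  lift r3 to coprimeDenSubring p using hr3
  lift r4 to coprimeDenSubring p using hr4
  refine ⟨((3 : ℕ) : ℚ)⁻¹ * (2 * q * B - 2 * (3 - p * q) * r3 + (1 + p * q - 3 * q) * (C + p * r4)
    + 8 * r2 - 2 * (1 + p * q) * r1 : coprimeDenSubring p) - r4,
    sub_mem (mul_mem hi3 (Subtype.prop _)) (Subtype.prop _), ?_⟩
  refine mul_left_cancel₀ hp0 ?_
  have c2 : ((2 : coprimeDenSubring p) : ℚ) = 2 := rfl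
  have c3 : ((3 : coprimeDenSubring p) : ℚ) = 3 := rfl
  have c8 : ((8 : coprimeDenSubring p) : ℚ) = 8 := rfl
  push_cast
  rw [c2, c3, c8]
  linear_combination (8 / 3) * h2 - (2 / 3) * (1 + p * q) * h1

end

/-- Congruence for `H(-1; p-1)` modulo `p³`. -/
theorem H_neg_one_mod_p_cubed (p : ℕ) (hp : p.Prime) (hp5 : 5 ≤ p) :
    pcong (p ^ 3) (H [-1] (p - 1))
      (-2 * qp p + p * (qp p) ^ 2 - (2 / 3) * (p : ℚ) ^ 2 * (qp p) ^ 3 -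
        (1 / 4) * (p : ℚ) ^ 2 * bernoulli (p - 3)) := by
  obtain ⟨m, hm⟩ := hp.odd_of_ne_two (by omega)
  obtain ⟨r1, hr1, h1⟩ := invPowSum_one_two_mul hp hm
  obtain ⟨r2, hr2, h2⟩ := invPowSum_two_eq hp hm
  obtain ⟨r3, hr3, h3⟩ := invPowSum_one_eq hp hp5 hm
  obtain ⟨r4, hr4, h4⟩ := invPowSum_three_eq hp hp5 hm
  have hi2 := inv_natCast_mem_coprimeDenSubring
    (coprime_of_pos_of_lt hp (n := 2) (by omega) (by omega))
  have hi3 := inv_natCast_mem_coprimeDenSubring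
    (coprime_of_pos_of_lt hp (n := 3) (by omega) (by omega))
  refine pow_dvd_num_of_eq_mul
    (z := r3 - r1 + ((2 : ℕ) : ℚ)⁻¹ ^ 3 * ((3 : ℕ) : ℚ)⁻¹ * r2 + ((2 : ℕ) : ℚ)⁻¹ ^ 3 * r4) ?_ ?_
  · exact add_mem (add_mem (sub_mem hr3 hr1) (mul_mem (mul_mem (pow_mem hi2 _) hi3) hr2))
      (mul_mem (pow_mem hi2 _) hr4)
  · rw [H_neg_one_eq hm]
    unfold truncLog at h3
    push_cast
    linear_combination h3 - h1 + p / 24 * h2 + p ^ 2 / 8 * h4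
end

section
/- For all positive integers d and m, the polynomial identity \sum_{1\le n_1\le \cdots \le n_d\le m} \frac{(1-x)^{n_1}-1}{n_1\cdots n_d} = \sum_{j=1}^{m} \frac{(-x)^j}{j^d}\binom{m}{j} holds in \mathbb{Q}[x]. Moreover, for every odd prime p, the congruence \sum_{1\le n_1\le \cdots \le n_d\le p-1} \frac{(1-x)^{n_1}-1}{n_1\cdots n_d} \equiv \sum_{j=1}^{p-1} \frac{x^j}{j^d}\big(1 - p H(1;j) + p^2 H(1,1;j)\big) \pmod{p^3} holds coefficientwise in \mathbb{Q}[x] (all coefficients involved are p-integral). -/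
open Finset

/-- `gpoly d m` is the polynomial `∑_{1 ≤ n₁ ≤ ⋯ ≤ n_d ≤ m} ((1-x)^{n₁} - 1)/(n₁⋯n_d)`
    (for `d ≥ 1`), defined by peeling the outermost index; the base case `d = 0`
    is the auxiliary polynomial `(1-x)^m - 1`. -/
noncomputable def gpoly : ℕ → ℕ → Polynomial ℚ
  | 0, m => (1 - Polynomial.X) ^ m - 1
  | d + 1, m => ∑ n ∈ Finset.Icc 1 m, Polynomial.C ((n : ℚ)⁻¹) * gpoly d n

theorem sum_inv_mul_choose (i m : ℕ) (hi : i ≠ 0) :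
    ∑ n ∈ Finset.Icc 1 m, (n : ℚ)⁻¹ * (Nat.choose n i : ℚ) = (Nat.choose m i : ℚ) / i := by
  obtain ⟨k, rfl⟩ := Nat.exists_eq_succ_of_ne_zero hi
  induction m with
  | zero => simp
  | succ m ih =>
    rw [Finset.sum_Icc_succ_top (by omega), ih]
    have h1 : ((m + 1 : ℕ) : ℚ) * (m.choose k : ℚ) = ((m + 1).choose (k + 1) : ℚ) * (k + 1 : ℕ) := by
      exact_mod_cast Nat.add_one_mul_choose_eq m k
    have h2 : ((m + 1).choose (k + 1) : ℚ) = m.choose k + m.choose (k + 1) := by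
      exact_mod_cast Nat.choose_succ_succ m k
    have hm : ((m + 1 : ℕ) : ℚ) ≠ 0 := by positivity
    have hk : ((k + 1 : ℕ) : ℚ) ≠ 0 := by positivity
    simp only [Nat.succ_eq_add_one]
    field_simp
    linear_combination (-((m + 1 : ℕ) : ℚ)) * h2 - h1

theorem gpoly_coeff (d m i : ℕ) :
    (gpoly d m).coeff i =
      if i = 0 then 0 else (-1 : ℚ) ^ i * (Nat.choose m i : ℚ) / (i : ℚ) ^ d := by
  induction d generalizing m with
  | zero =>
    have h : (1 - Polynomial.X : Polynomial ℚ) ^ m =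
        ((1 + Polynomial.X) ^ m).comp (Polynomial.C (-1) * Polynomial.X) := by
      simp [sub_eq_add_neg]
    rw [gpoly, Polynomial.coeff_sub, h, Polynomial.comp_C_mul_X_coeff,
      Polynomial.coeff_one_add_X_pow, Polynomial.coeff_one]
    split_ifs with hi <;> simp [hi, mul_comm]
  | succ d ih =>
    simp only [gpoly, Polynomial.finsetSum_coeff, Polynomial.coeff_C_mul, ih]
    split_ifs with hi
    · simp
    · rw [show (-1 : ℚ) ^ i * (m.choose i : ℚ) / (i : ℚ) ^ (d + 1) =
          (-1) ^ i / (i : ℚ) ^ d * ((m.choose i : ℚ) / i) by ring,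
        ← sum_inv_mul_choose i m hi, Finset.mul_sum]
      refine Finset.sum_congr rfl fun n _ => ?_
      ring

theorem coeff_sum_Icc_C_mul_X_pow (f : ℕ → ℚ) (m i : ℕ) :
    (∑ j ∈ Finset.Icc 1 m, Polynomial.C (f j) * Polynomial.X ^ j).coeff i =
      if i ∈ Finset.Icc 1 m then f i else 0 := by
  simp [Polynomial.coeff_X_pow]

theorem H_one_succ (j : ℕ) : H [1] (j + 1) = H [1] j + ((j + 1 : ℕ) : ℚ)⁻¹ := by
  simp [H, Hrev, sgn, Finset.sum_Icc_succ_top]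

theorem H_one_one_succ (j : ℕ) :
    H [1, 1] (j + 1) = H [1, 1] j + ((j + 1 : ℕ) : ℚ)⁻¹ * H [1] j := by
  simp [H, Hrev, sgn, Finset.sum_Icc_succ_top]

theorem padicNorm_add_le_one {p : ℕ} [Fact p.Prime] {x y : ℚ}
    (hx : padicNorm p x ≤ 1) (hy : padicNorm p y ≤ 1) : padicNorm p (x + y) ≤ 1 :=
  padicNorm.nonarchimedean.trans (max_le hx hy)

theorem padicNorm_mul_le_one {p : ℕ} [Fact p.Prime] {x y : ℚ}
    (hx : padicNorm p x ≤ 1) (hy : padicNorm p y ≤ 1) : padicNorm p (x * y) ≤ 1 := by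
  rw [padicNorm.mul]
  exact mul_le_one₀ hx (padicNorm.nonneg _) hy

theorem padicNorm_inv_natCast_le_one {p : ℕ} [Fact p.Prime] {n : ℕ} (h0 : n ≠ 0) (hn : n < p) :
    padicNorm p (n : ℚ)⁻¹ ≤ 1 := by
  have h : padicNorm p (n : ℚ) = 1 :=
    (padicNorm.nat_eq_one_iff n).2 (Nat.not_dvd_of_pos_of_lt (Nat.pos_of_ne_zero h0) hn)
  rw [← one_div, padicNorm.div, h]
  simp

theorem pcong_of_sub_eq {p : ℕ} [Fact p.Prime] {k : ℕ} {x y r : ℚ}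
    (hr : padicNorm p r ≤ 1) (h : x - y = (p : ℚ) ^ k * r) : pcong (p ^ k) x y := by
  unfold pcong
  rw [padicNorm.dvd_iff_norm_le]
  have hnum : ((x - y).num : ℚ) = (p : ℚ) ^ k * (r * ((x - y).den : ℤ)) := by
    rw [← mul_assoc, ← h]
    exact_mod_cast (Rat.mul_den_eq_num (x - y)).symm
  have hpk : padicNorm p ((p : ℚ) ^ k) = (p : ℚ) ^ (-k : ℤ) := by
    rw [IsAbsoluteValue.abv_pow (padicNorm p), padicNorm.padicNorm_p_of_prime, inv_pow,
      zpow_neg, zpow_natCast]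
  rw [hnum, padicNorm.mul, hpk]
  exact mul_le_of_le_one_right (by positivity)
    (padicNorm_mul_le_one hr (padicNorm.of_int _))

theorem exists_neg_one_pow_mul_choose_eq {p : ℕ} [hp : Fact p.Prime] (j : ℕ) (hj : j < p) :
    padicNorm p (H [1] j) ≤ 1 ∧ padicNorm p (H [1, 1] j) ≤ 1 ∧
      ∃ r : ℚ, padicNorm p r ≤ 1 ∧
        (-1 : ℚ) ^ j * (Nat.choose (p - 1) j : ℚ) =
          1 - (p : ℚ) * H [1] j + (p : ℚ) ^ 2 * H [1, 1] j + (p : ℚ) ^ 3 * r := by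
  induction j with
  | zero => exact ⟨by simp [H, Hrev], by simp [H, Hrev], 0, by simp, by simp [H, Hrev]⟩
  | succ j ih =>
    obtain ⟨h1, h2, r, hr, he⟩ := ih (by omega)
    have hinv := padicNorm_inv_natCast_le_one (p := p) (Nat.succ_ne_zero j) hj
    have hpos : ((j + 1 : ℕ) : ℚ) ≠ 0 := by positivity
    have hneg : padicNorm p (-(p : ℚ)) ≤ 1 := by
      rw [padicNorm.neg]
      exact padicNorm.of_nat p
    refine ⟨?_, ?_, r + ((j + 1 : ℕ) : ℚ)⁻¹ * (-H [1, 1] j + -(p : ℚ) * r), ?_, ?_⟩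
    · rw [H_one_succ]
      exact padicNorm_add_le_one h1 hinv
    · rw [H_one_one_succ]
      exact padicNorm_add_le_one h2 (padicNorm_mul_le_one hinv h1)
    · exact padicNorm_add_le_one hr (padicNorm_mul_le_one hinv
        (padicNorm_add_le_one (by rwa [padicNorm.neg]) (padicNorm_mul_le_one hneg hr)))
    · have hc : ((p - 1).choose (j + 1) : ℚ) * (j + 1 : ℕ) =
          ((p - 1).choose j : ℚ) * ((p : ℚ) - (j + 1 : ℕ)) := by
        rw [← Nat.cast_sub hj.le, show p - (j + 1) = p - 1 - j by omega]
        exact_mod_cast Nat.choose_succ_right_eq (p - 1) j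
      have hc' : ((p - 1).choose (j + 1) : ℚ) =
          ((p - 1).choose j : ℚ) * ((p : ℚ) * ((j + 1 : ℕ) : ℚ)⁻¹ - 1) := by
        field_simp
        linear_combination hc
      rw [H_one_succ, H_one_one_succ, hc', pow_succ]
      linear_combination (1 - (p : ℚ) * ((j + 1 : ℕ) : ℚ)⁻¹) * he

/-- The polynomial identity
    `∑_{1≤n₁≤⋯≤n_d≤m} ((1-x)^{n₁}-1)/(n₁⋯n_d) = ∑_{j=1}^m (-x)^j C(m,j)/j^d` in `ℚ[x]`,
    together with the coefficientwise congruence modulo `p³` for `m = p - 1`. -/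
theorem nested_sum_polynomial_identity :
    (∀ d m : ℕ, 0 < d → 0 < m →
      gpoly d m =
        ∑ j ∈ Finset.Icc 1 m,
          Polynomial.C ((-1 : ℚ) ^ j * (Nat.choose m j : ℚ) / (j : ℚ) ^ d) *
            Polynomial.X ^ j) ∧
    (∀ (p : ℕ), p.Prime → Odd p → ∀ d : ℕ, 0 < d → ∀ i : ℕ,
      pcong (p ^ 3) ((gpoly d (p - 1)).coeff i)
        ((∑ j ∈ Finset.Icc 1 (p - 1),
            Polynomial.C
              ((1 : ℚ) / (j : ℚ) ^ d *
                (1 - (p : ℚ) * H [1] j + (p : ℚ) ^ 2 * H [1, 1] j)) *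
              Polynomial.X ^ j).coeff i)) := by
  refine ⟨fun d m _ _ => ?_, fun p hp _ d _ i => ?_⟩
  · ext i
    rw [gpoly_coeff, coeff_sum_Icc_C_mul_X_pow]
    by_cases hi : i = 0
    · simp [hi]
    · by_cases him : i ≤ m
      · simp [hi, him, Nat.one_le_iff_ne_zero]
      · simp [hi, him, Nat.choose_eq_zero_of_lt (not_le.1 him)]
  · have : Fact p.Prime := ⟨hp⟩
    rw [gpoly_coeff, coeff_sum_Icc_C_mul_X_pow]
    by_cases hi : i = 0
    · simp [hi, pcong]
    · by_cases hip : i ≤ p - 1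
      · have hlt : i < p := by have := hp.pos; omega
        obtain ⟨-, -, r, hr, he⟩ := exists_neg_one_pow_mul_choose_eq (p := p) i hlt
        have hpow : padicNorm p (((i : ℚ)⁻¹) ^ d) ≤ 1 := by
          rw [IsAbsoluteValue.abv_pow (padicNorm p)]
          exact pow_le_one₀ (padicNorm.nonneg _) (padicNorm_inv_natCast_le_one hi hlt)
        refine pcong_of_sub_eq (padicNorm_mul_le_one hpow hr) ?_
        rw [if_neg hi, if_pos (Finset.mem_Icc.2 ⟨Nat.one_le_iff_ne_zero.2 hi, hip⟩), he]
        ring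
      · simp [hi, hip, pcong, Nat.choose_eq_zero_of_lt (not_le.1 hip)]
end

section
/- Let n be a nonnegative integer and p a prime with p > n+2. Writing H(-)=H(-;p-1), S(-)=S(-;p-1), U(-)=U(-;p-1), V(-)=V(-;p-1), one has H(-1,\{1\}^n) \equiv S(-1,\{1\}^n) \equiv (-1)^n H(\{1\}^n,-1) \equiv (-1)^n S(\{1\}^n,-1) \equiv U(-n-1) \equiv (-1)^{n+1}\, 2\, V(-n-1) \pmod{p}. -/
open Finset

/-- `U(-m; n) = ∑_{k=1}^n 2^k / k^m`. -/
def U1 (m n : ℕ) : ℚ := ∑ k ∈ Finset.Icc 1 n, 2 ^ k / (k : ℚ) ^ m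

/-- `V(-m; n) = ∑_{k=1}^n 1 / (2^k k^m)`. -/
def V1 (m n : ℕ) : ℚ := ∑ k ∈ Finset.Icc 1 n, 1 / (2 ^ k * (k : ℚ) ^ m)

section FieldSums

variable (F : Type*) [Field F]

/-- Weight `sign(s)^k / k^|s|` in a field. -/
def weight (s : ℤ) (k : ℕ) : F := (if s < 0 then -1 else 1) ^ k / (k : F) ^ s.natAbs

/-- The analogue of `Hrev` with values in a field. -/
def HrevField : List ℤ → ℕ → F
  | [], _ => 1
  | s :: t, n => ∑ k ∈ Finset.Icc 1 n, weight F s k * HrevField t (k - 1)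

/-- The analogue of `Srev` with values in a field. -/
def SrevField : List ℤ → ℕ → F
  | [], _ => 1
  | s :: t, n => ∑ k ∈ Finset.Icc 1 n, weight F s k * SrevField t k

variable {F}

lemma weight_one (k : ℕ) : weight F 1 k = (k : F)⁻¹ := by simp [weight]

lemma weight_neg_one (k : ℕ) : weight F (-1) k = (-1) ^ k / (k : F) := by simp [weight]

lemma HrevField_cons_zero (s : ℤ) (t : List ℤ) : HrevField F (s :: t) 0 = 0 := by
  simp [HrevField]

lemma SrevField_cons_zero (s : ℤ) (t : List ℤ) : SrevField F (s :: t) 0 = 0 := by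
  simp [SrevField]

lemma HrevField_cons_succ (s : ℤ) (t : List ℤ) (N : ℕ) :
    HrevField F (s :: t) (N + 1) =
      HrevField F (s :: t) N + weight F s (N + 1) * HrevField F t N := by
  simp [HrevField, Finset.sum_Icc_succ_top]

lemma SrevField_cons_succ (s : ℤ) (t : List ℤ) (N : ℕ) :
    SrevField F (s :: t) (N + 1) =
      SrevField F (s :: t) N + weight F s (N + 1) * SrevField F t (N + 1) := by
  simp [SrevField, Finset.sum_Icc_succ_top]

variable (F) in
/-- Generating function of `c ^ n * H({1}ⁿ; N)`. -/
noncomputable def genH (c : F) (N : ℕ) : PowerSeries F :=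
  PowerSeries.mk fun n => c ^ n * HrevField F (List.replicate n 1) N

variable (F) in
/-- Generating function of `S({1}ⁿ; N)`. -/
noncomputable def genS (N : ℕ) : PowerSeries F :=
  PowerSeries.mk fun n => SrevField F (List.replicate n 1) N

variable (F) in
/-- Generating function of `c ^ n * H({1}ⁿ, s; N)`. -/
noncomputable def genHOuter (s : ℤ) (c : F) (N : ℕ) : PowerSeries F :=
  PowerSeries.mk fun n => c ^ n * HrevField F (s :: List.replicate n 1) N

variable (F) in
/-- Generating function of `S({1}ⁿ, s; N)`. -/
noncomputable def genSOuter (s : ℤ) (N : ℕ) : PowerSeries F :=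
  PowerSeries.mk fun n => SrevField F (s :: List.replicate n 1) N

variable (F) in
/-- Generating function of `c ^ n * H(s, {1}ⁿ; N)`. -/
noncomputable def genHInner (s : ℤ) (c : F) (N : ℕ) : PowerSeries F :=
  PowerSeries.mk fun n => c ^ n * HrevField F (List.replicate n 1 ++ [s]) N

variable (F) in
/-- Generating function of `S(s, {1}ⁿ; N)`. -/
noncomputable def genSInner (s : ℤ) (N : ℕ) : PowerSeries F :=
  PowerSeries.mk fun n => SrevField F (List.replicate n 1 ++ [s]) N

open PowerSeries in
lemma genH_succ (c : F) (N : ℕ) :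
    genH F c (N + 1) = genH F c N * (1 + C (c * ((N + 1 : ℕ) : F)⁻¹) * X) := by
  ext n
  rcases n with _ | n
  · simp [genH, HrevField, mul_add, ← mul_assoc]
  · rw [mul_add, mul_one, ← mul_assoc, map_add, coeff_succ_mul_X, coeff_mul_C]
    simp only [genH, coeff_mk, List.replicate_succ, HrevField_cons_succ, weight_one]
    ring

open PowerSeries in
lemma genS_succ (N : ℕ) :
    genS F (N + 1) * (1 - C (((N + 1 : ℕ) : F)⁻¹) * X) = genS F N := by
  ext n
  rcases n with _ | n
  · simp [genS, SrevField, mul_sub, ← mul_assoc]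
  · rw [mul_sub, mul_one, ← mul_assoc, map_sub, coeff_succ_mul_X, coeff_mul_C]
    simp only [genS, coeff_mk, List.replicate_succ, SrevField_cons_succ, weight_one]
    ring

open PowerSeries in
lemma genHOuter_succ (s : ℤ) (c : F) (N : ℕ) :
    genHOuter F s c (N + 1) = genHOuter F s c N + C (weight F s (N + 1)) * genH F c N := by
  ext n
  simp only [genHOuter, genH, map_add, coeff_C_mul, coeff_mk, HrevField_cons_succ]
  ring

open PowerSeries in
lemma genSOuter_succ (s : ℤ) (N : ℕ) :
    genSOuter F s (N + 1) = genSOuter F s N + C (weight F s (N + 1)) * genS F (N + 1) := by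
  ext n
  simp only [genSOuter, genS, map_add, coeff_C_mul, coeff_mk, SrevField_cons_succ]

open PowerSeries in
lemma genHInner_succ (s : ℤ) (c : F) (N : ℕ) :
    genHInner F s c (N + 1) =
      genHInner F s c N * (1 + C (c * ((N + 1 : ℕ) : F)⁻¹) * X) + C (weight F s (N + 1)) := by
  ext n
  rcases n with _ | n
  · simp [genHInner, HrevField_cons_succ, HrevField, mul_add, ← mul_assoc]
  · rw [mul_add, mul_one, ← mul_assoc, map_add, map_add, coeff_succ_mul_X, coeff_mul_C]
    simp only [genHInner, coeff_mk, List.replicate_succ, List.cons_append, HrevField_cons_succ,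
      weight_one, coeff_C, Nat.succ_ne_zero, if_false]
    ring

open PowerSeries in
lemma genSInner_succ (s : ℤ) (N : ℕ) :
    genSInner F s (N + 1) * (1 - C (((N + 1 : ℕ) : F)⁻¹) * X) =
      genSInner F s N + C (weight F s (N + 1)) := by
  ext n
  rcases n with _ | n
  · simp [genSInner, SrevField_cons_succ, SrevField, mul_sub, ← mul_assoc]
  · rw [mul_sub, mul_one, ← mul_assoc, map_sub, map_add, coeff_succ_mul_X, coeff_mul_C]
    simp only [genSInner, coeff_mk, List.replicate_succ, List.cons_append, SrevField_cons_succ,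
      weight_one, coeff_C, Nat.succ_ne_zero, if_false]
    ring

lemma genH_zero (c : F) : genH F c 0 = 1 := by
  ext n
  rcases n with _ | n
  · simp [genH, HrevField]
  · simp [genH, List.replicate_succ, HrevField_cons_zero, PowerSeries.coeff_one]

lemma genS_zero : genS F 0 = 1 := by
  ext n
  rcases n with _ | n
  · simp [genS, SrevField]
  · simp [genS, List.replicate_succ, SrevField_cons_zero, PowerSeries.coeff_one]

lemma genHOuter_zero (s : ℤ) (c : F) : genHOuter F s c 0 = 0 := by
  ext n
  simp [genHOuter, HrevField_cons_zero]

lemma genSOuter_zero (s : ℤ) : genSOuter F s 0 = 0 := by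
  ext n
  simp [genSOuter, SrevField_cons_zero]

lemma genHInner_zero (s : ℤ) (c : F) : genHInner F s c 0 = 0 := by
  ext n
  rcases n with _ | n <;>
    simp [genHInner, List.replicate_succ, HrevField_cons_zero]

lemma genSInner_zero (s : ℤ) : genSInner F s 0 = 0 := by
  ext n
  rcases n with _ | n <;>
    simp [genSInner, List.replicate_succ, SrevField_cons_zero]

lemma genH_neg_one_succ (N : ℕ) :
    genH F (-1) (N + 1) =
      genH F (-1) N * (1 - PowerSeries.C (((N + 1 : ℕ) : F)⁻¹) * PowerSeries.X) := by
  rw [genH_succ, neg_one_mul, map_neg, neg_mul, sub_eq_add_neg]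

lemma genS_mul_genH (N : ℕ) : genS F N * genH F (-1) N = 1 := by
  induction N with
  | zero => simp [genS_zero, genH_zero]
  | succ N ih =>
    rw [genH_neg_one_succ]
    linear_combination ih + genH F (-1) N * genS_succ (F := F) N

lemma genSInner_mul_genH (s : ℤ) (N : ℕ) :
    genSInner F s N * genH F (-1) N = genHOuter F s (-1) N := by
  induction N with
  | zero => simp [genSInner_zero, genHOuter_zero]
  | succ N ih =>
    rw [genH_neg_one_succ, genHOuter_succ, ← ih]
    linear_combination genH F (-1) N * genSInner_succ (F := F) s N

lemma genS_mul_genHInner (s : ℤ) (N : ℕ) :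
    genS F N * genHInner F s (-1) N = genSOuter F s N := by
  induction N with
  | zero => simp [genHInner_zero, genSOuter_zero]
  | succ N ih =>
    rw [genHInner_succ, genSOuter_succ, ← ih, neg_one_mul, map_neg]
    linear_combination genHInner F s (-1) N * genS_succ (F := F) N

lemma genHOuter_eq_sum (s : ℤ) (c : F) (N : ℕ) :
    genHOuter F s c N =
      ∑ k ∈ Finset.range N, PowerSeries.C (weight F s (k + 1)) * genH F c k := by
  induction N with
  | zero => simp [genHOuter_zero]
  | succ N ih => rw [genHOuter_succ, Finset.sum_range_succ, ih]

lemma genSOuter_eq_sum (s : ℤ) (N : ℕ) :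
    genSOuter F s N =
      ∑ k ∈ Finset.range N, PowerSeries.C (weight F s (k + 1)) * genS F (k + 1) := by
  induction N with
  | zero => simp [genSOuter_zero]
  | succ N ih => rw [genSOuter_succ, Finset.sum_range_succ, ih]

/-- The binomial sum `∑ (-1)^(k-1) C(N,k) t^k / k^m`. -/
def binomSum (t : F) (m N : ℕ) : F :=
  ∑ k ∈ Finset.Icc 1 N, (-1) ^ (k + 1) * (N.choose k : F) * t ^ k / (k : F) ^ m

lemma binomSum_depth_zero (t : F) (N : ℕ) : binomSum t 0 N = 1 - (1 - t) ^ N := by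
  have h : (1 - t) ^ N = ∑ k ∈ Finset.range (N + 1), (-t) ^ k * (N.choose k : F) := by
    rw [show 1 - t = -t + 1 by ring, add_pow]
    simp
  rw [h, Finset.sum_range_succ', binomSum, Finset.range_eq_Ico,
    Finset.sum_Ico_add' (fun k => (-t) ^ k * (N.choose k : F)) 0 N 1]
  simp only [pow_zero, Nat.choose_zero_right, Nat.cast_one, mul_one, sub_add_cancel_right, zero_add]
  rw [← Finset.sum_neg_distrib]
  refine Finset.sum_congr (by ext; simp) fun k _ => ?_
  rw [neg_pow t]
  ring

lemma binomSum_succ (t : F) (m N : ℕ) (hN : ∀ k ∈ Finset.Icc 1 (N + 1), (k : F) ≠ 0) :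
    binomSum t (m + 1) (N + 1) =
      binomSum t (m + 1) N + ((N + 1 : ℕ) : F)⁻¹ * binomSum t m (N + 1) := by
  have h : binomSum t (m + 1) N = ∑ k ∈ Finset.Icc 1 (N + 1),
      (-1) ^ (k + 1) * (N.choose k : F) * t ^ k / (k : F) ^ (m + 1) := by
    rw [Finset.sum_Icc_succ_top (by omega)]
    simp [binomSum]
  rw [h, binomSum, binomSum, Finset.mul_sum, ← Finset.sum_add_distrib]
  refine Finset.sum_congr rfl fun k hk => ?_
  have hk0 := hN k hk
  have hN0 := hN (N + 1) (by simp)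
  obtain ⟨j, rfl⟩ : ∃ j, k = j + 1 := ⟨k - 1, by simp at hk; omega⟩
  have h1 : (((N + 1).choose (j + 1) : ℕ) : F) = N.choose j + N.choose (j + 1) := by
    rw [Nat.choose_succ_succ]; push_cast; rfl
  have h2 : ((N + 1 : ℕ) : F) * N.choose j = (N + 1).choose (j + 1) * ((j + 1 : ℕ) : F) := by
    exact_mod_cast congrArg (Nat.cast (R := F)) (Nat.add_one_mul_choose_eq N j)
  have h3 : (((N + 1).choose (j + 1) : ℕ) : F) =
      N.choose (j + 1) + ((N + 1 : ℕ) : F)⁻¹ * ((j + 1 : ℕ) : F) * (N + 1).choose (j + 1) := by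
    rw [mul_assoc, mul_comm ((j + 1 : ℕ) : F), ← h2, inv_mul_cancel_left₀ hN0, h1, add_comm]
  have h4 : ((j + 1 : ℕ) : F) / ((j + 1 : ℕ) : F) ^ (m + 1) = 1 / ((j + 1 : ℕ) : F) ^ m := by
    rw [pow_succ]; field_simp
  linear_combination (-1) ^ (j + 1 + 1) * t ^ (j + 1) / ((j + 1 : ℕ) : F) ^ (m + 1) * h3 +
    (-1) ^ (j + 1 + 1) * t ^ (j + 1) * ((N + 1 : ℕ) : F)⁻¹ * ((N + 1).choose (j + 1) : F) * h4

lemma binomSum_succ_eq_sum (t : F) (m N : ℕ) (hN : ∀ k ∈ Finset.Icc 1 N, (k : F) ≠ 0) :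
    binomSum t (m + 1) N = ∑ k ∈ Finset.Icc 1 N, (k : F)⁻¹ * binomSum t m k := by
  induction N with
  | zero => simp [binomSum]
  | succ N ih =>
    rw [binomSum_succ t m N hN, Finset.sum_Icc_succ_top (by omega), ih]
    intro k hk
    exact hN k (by simp at hk ⊢; omega)

lemma binomSum_one (m N : ℕ) (hN : ∀ k ∈ Finset.Icc 1 N, (k : F) ≠ 0) :
    binomSum 1 (m + 1) N = SrevField F (List.replicate (m + 1) 1) N := by
  induction m generalizing N with
  | zero =>
    rw [binomSum_succ_eq_sum 1 0 N hN]
    refine Finset.sum_congr rfl fun k hk => ?_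
    have : k ≠ 0 := by simp at hk; omega
    simp [binomSum_depth_zero, weight_one, SrevField, this]
  | succ m ih =>
    rw [binomSum_succ_eq_sum 1 _ N hN, List.replicate_succ, SrevField]
    refine Finset.sum_congr rfl fun k hk => ?_
    rw [weight_one, ih]
    intro j hj
    exact hN j (by simp at hk hj ⊢; omega)

lemma binomSum_two (m N : ℕ) (hN : ∀ k ∈ Finset.Icc 1 N, (k : F) ≠ 0) :
    binomSum 2 (m + 1) N = SrevField F (List.replicate (m + 1) 1) N -
      SrevField F (List.replicate m 1 ++ [-1]) N := by
  induction m generalizing N with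
  | zero =>
    rw [binomSum_succ_eq_sum 2 0 N hN]
    simp only [SrevField, List.replicate_succ, List.replicate_zero, List.nil_append,
      ← Finset.sum_sub_distrib]
    refine Finset.sum_congr rfl fun k hk => ?_
    rw [binomSum_depth_zero, weight_one, weight_neg_one]
    ring
  | succ m ih =>
    rw [binomSum_succ_eq_sum 2 _ N hN, List.replicate_succ, List.replicate_succ (n := m),
      List.cons_append, SrevField, SrevField, ← Finset.sum_sub_distrib]
    refine Finset.sum_congr rfl fun k hk => ?_
    rw [weight_one, ih, List.replicate_succ, mul_sub]
    intro j hj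
    exact hN j (by simp at hk hj ⊢; omega)

end FieldSums

section ModPrime

variable {p : ℕ} [Fact p.Prime]

lemma natCast_ne_zero_of_mem_Icc {k : ℕ} (hk : k ∈ Finset.Icc 1 (p - 1)) : (k : ZMod p) ≠ 0 := by
  rw [Ne, ZMod.natCast_eq_zero_iff]
  rw [Finset.mem_Icc] at hk
  exact Nat.not_dvd_of_pos_of_lt (by omega) (by omega)

lemma natCast_prime_sub {k : ℕ} (hk : k ≤ p) : ((p - k : ℕ) : ZMod p) = -k := by
  simp [Nat.cast_sub hk]

lemma neg_one_pow_mul_choose_prime_sub_one {k : ℕ} (hk : k ≤ p - 1) :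
    (-1) ^ k * ((p - 1).choose k : ZMod p) = 1 := by
  induction k with
  | zero => simp
  | succ k ih =>
    have hp : p.Prime := Fact.out
    have h : ((p.choose (k + 1) : ℕ) : ZMod p) = 0 := by
      rw [ZMod.natCast_eq_zero_iff]
      exact hp.dvd_choose_self (by omega) (by omega)
    obtain ⟨q, rfl⟩ : ∃ q, p = q + 1 := ⟨p - 1, by have := hp.pos; omega⟩
    rw [Nat.choose_succ_succ, Nat.cast_add] at h
    have := ih (by omega)
    simp only [Nat.add_sub_cancel, Nat.succ_eq_add_one] at *
    rw [pow_succ]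
    linear_combination this - (-1) ^ k * h

lemma binomSum_prime_sub_one (t : ZMod p) (m : ℕ) :
    binomSum t m (p - 1) = -∑ k ∈ Finset.Icc 1 (p - 1), t ^ k / (k : ZMod p) ^ m := by
  rw [binomSum, ← Finset.sum_neg_distrib]
  refine Finset.sum_congr rfl fun k hk => ?_
  have := neg_one_pow_mul_choose_prime_sub_one (Finset.mem_Icc.mp hk).2
  rw [pow_succ]
  linear_combination -(t ^ k / (k : ZMod p) ^ m) * this

lemma sum_inv_pow_eq_zero {m : ℕ} (hm : 0 < m) (hmp : m < p - 1) :
    ∑ k ∈ Finset.Icc 1 (p - 1), 1 / (k : ZMod p) ^ m = 0 := by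
  have hp : p.Prime := Fact.out
  have h := FiniteField.sum_pow_lt_card_sub_one (ZMod p) (p - 1 - m) (by rw [ZMod.card]; omega)
  rw [← h, ← Finset.sum_erase (a := (0 : ZMod p)) Finset.univ (by simp; omega)]
  refine Finset.sum_nbij' (fun k : ℕ => (k : ZMod p)) ZMod.val ?_ ?_ ?_ ?_ ?_
  · intro k hk
    simpa using natCast_ne_zero_of_mem_Icc hk
  · intro x hx
    have h1 := ZMod.val_lt x
    have h2 : x.val ≠ 0 := by simpa [ZMod.val_eq_zero] using hx
    simp only [Finset.mem_Icc]
    omega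
  · intro k hk
    rw [Finset.mem_Icc] at hk
    exact ZMod.val_cast_of_lt (by omega)
  · intro x _
    exact ZMod.natCast_zmod_val x
  · intro k hk
    have hk0 := natCast_ne_zero_of_mem_Icc hk
    rw [div_eq_iff (pow_ne_zero _ hk0), ← pow_add, Nat.sub_add_cancel hmp.le,
      ZMod.pow_card_sub_one_eq_one hk0]

lemma SrevField_ones_eq_zero {m : ℕ} (hm : 0 < m) (hmp : m < p - 1) :
    SrevField (ZMod p) (List.replicate m 1) (p - 1) = 0 := by
  obtain ⟨m, rfl⟩ : ∃ j, m = j + 1 := ⟨m - 1, by omega⟩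
  rw [← binomSum_one m _ fun _ => natCast_ne_zero_of_mem_Icc, binomSum_prime_sub_one]
  simp only [one_pow, sum_inv_pow_eq_zero hm hmp, neg_zero]

lemma SrevField_ones_neg_one {n : ℕ} (hn : n + 2 < p) :
    SrevField (ZMod p) (List.replicate n 1 ++ [-1]) (p - 1) =
      ∑ k ∈ Finset.Icc 1 (p - 1), 2 ^ k / (k : ZMod p) ^ (n + 1) := by
  have h := binomSum_two (F := ZMod p) n _ fun _ => natCast_ne_zero_of_mem_Icc
  rw [binomSum_prime_sub_one, SrevField_ones_eq_zero (by omega) (by omega), zero_sub] at h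
  exact (neg_injective h).symm

lemma X_pow_dvd_genS_sub_one :
    (PowerSeries.X : PowerSeries (ZMod p)) ^ (p - 1) ∣ genS (ZMod p) (p - 1) - 1 := by
  rw [PowerSeries.X_pow_dvd_iff]
  intro m hm
  rcases m.eq_zero_or_pos with rfl | h0
  · simp [genS, SrevField]
  · simp [genS, SrevField_ones_eq_zero h0 hm, PowerSeries.coeff_one, h0.ne']

lemma X_pow_dvd_genH_sub_one :
    (PowerSeries.X : PowerSeries (ZMod p)) ^ (p - 1) ∣ genH (ZMod p) (-1) (p - 1) - 1 := by
  obtain ⟨r, hr⟩ := X_pow_dvd_genS_sub_one (p := p)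
  refine ⟨-r * genH (ZMod p) (-1) (p - 1), ?_⟩
  linear_combination genS_mul_genH (F := ZMod p) (p - 1) - genH (ZMod p) (-1) (p - 1) * hr

lemma genH_mul_genH_reflect {k : ℕ} (hk : k ≤ p - 1) :
    genH (ZMod p) 1 (p - 1 - k) * genH (ZMod p) (-1) k = genH (ZMod p) 1 (p - 1) := by
  induction k with
  | zero => simp [genH_zero]
  | succ k ih =>
    rw [← ih (by omega), genH_neg_one_succ, show p - 1 - k = p - 1 - (k + 1) + 1 by omega,
      genH_succ, show p - 1 - (k + 1) + 1 = p - (k + 1) by omega,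
      natCast_prime_sub (by omega), inv_neg, one_mul, map_neg]
    ring

lemma genH_eq_genH_mul_genS {k : ℕ} (hk : k ≤ p - 1) :
    genH (ZMod p) 1 (p - 1 - k) = genH (ZMod p) (-1) (p - 1) * genS (ZMod p) k := by
  have h1 := genH_mul_genH_reflect hk
  have h2 := genH_mul_genH_reflect (p := p) le_rfl
  rw [Nat.sub_self, genH_zero, one_mul] at h2
  linear_combination -genH (ZMod p) 1 (p - 1 - k) * genS_mul_genH (F := ZMod p) k +
    genS (ZMod p) k * (h1 - h2)

lemma weight_neg_one_reflect (hp2 : p ≠ 2) {k : ℕ} (hk : k ≤ p) :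
    weight (ZMod p) (-1) (p - k) = weight (ZMod p) (-1) k := by
  have hp : p.Prime := Fact.out
  have h : (-1 : ZMod p) ^ (p - k) * (-1) ^ k = -1 := by
    rw [← pow_add, Nat.sub_add_cancel hk, (hp.odd_of_ne_two hp2).neg_one_pow]
  have h' : (-1 : ZMod p) ^ k * (-1) ^ k = 1 := by rw [← mul_pow]; simp
  rw [weight_neg_one, weight_neg_one, natCast_prime_sub hk, div_neg, ← neg_div]
  congr 1
  linear_combination (-1) ^ (p - k) * h' - (-1) ^ k * h

lemma genHOuter_eq_genH_mul_genSOuter (hp2 : p ≠ 2) :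
    genHOuter (ZMod p) (-1) 1 (p - 1) =
      genH (ZMod p) (-1) (p - 1) * genSOuter (ZMod p) (-1) (p - 1) := by
  rw [genHOuter_eq_sum, genSOuter_eq_sum, Finset.mul_sum, ← Finset.sum_range_reflect]
  refine Finset.sum_congr rfl fun k hk => ?_
  rw [Finset.mem_range] at hk
  rw [show p - 1 - 1 - k + 1 = p - (k + 1) by omega, weight_neg_one_reflect hp2 (by omega),
    show p - 1 - 1 - k = p - 1 - (k + 1) by omega, genH_eq_genH_mul_genS (by omega)]
  ring

lemma coeff_eq_of_mul_of_dvd {R : Type*} [CommRing R] {f g u : PowerSeries R} {N n : ℕ}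
    (h : u * f = g) (hu : PowerSeries.X ^ N ∣ u - 1) (hn : n < N) :
    PowerSeries.coeff n f = PowerSeries.coeff n g := by
  have hd : PowerSeries.X ^ N ∣ g - f := by
    rw [← h, show u * f - f = (u - 1) * f by ring]
    exact hu.mul_right f
  have := PowerSeries.X_pow_dvd_iff.mp hd n hn
  rw [map_sub, sub_eq_zero] at this
  exact this.symm

lemma SrevField_inner_eq {n : ℕ} (hn : n < p - 1) :
    SrevField (ZMod p) (List.replicate n 1 ++ [-1]) (p - 1) =
      (-1) ^ n * HrevField (ZMod p) (-1 :: List.replicate n 1) (p - 1) := by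
  simpa [genSInner, genHOuter] using coeff_eq_of_mul_of_dvd
    ((mul_comm _ _).trans (genSInner_mul_genH (F := ZMod p) (-1) (p - 1)))
    X_pow_dvd_genH_sub_one hn

lemma HrevField_inner_eq {n : ℕ} (hn : n < p - 1) :
    (-1) ^ n * HrevField (ZMod p) (List.replicate n 1 ++ [-1]) (p - 1) =
      SrevField (ZMod p) (-1 :: List.replicate n 1) (p - 1) := by
  simpa [genHInner, genSOuter] using coeff_eq_of_mul_of_dvd
    (genS_mul_genHInner (F := ZMod p) (-1) (p - 1)) X_pow_dvd_genS_sub_one hn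

lemma SrevField_outer_eq (hp2 : p ≠ 2) {n : ℕ} (hn : n < p - 1) :
    SrevField (ZMod p) (-1 :: List.replicate n 1) (p - 1) =
      HrevField (ZMod p) (-1 :: List.replicate n 1) (p - 1) := by
  simpa [genSOuter, genHOuter] using coeff_eq_of_mul_of_dvd
    (genHOuter_eq_genH_mul_genSOuter (p := p) hp2).symm X_pow_dvd_genH_sub_one hn

lemma sum_two_pow_div_pow (m : ℕ) :
    ∑ k ∈ Finset.Icc 1 (p - 1), 2 ^ k / (k : ZMod p) ^ m =
      (-1) ^ m * 2 * ∑ k ∈ Finset.Icc 1 (p - 1), 1 / ((2 : ZMod p) ^ k * (k : ZMod p) ^ m) := by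
  rw [Finset.mul_sum]
  rcases eq_or_ne (2 : ZMod p) 0 with h2 | h2
  · simp only [h2, mul_zero, zero_mul, Finset.sum_const_zero]
    refine Finset.sum_eq_zero fun k hk => ?_
    rw [Finset.mem_Icc] at hk
    rw [zero_pow (by omega), zero_div]
  refine Finset.sum_nbij' (fun k => p - k) (fun k => p - k) ?_ ?_ ?_ ?_ ?_
  · intro k hk; rw [Finset.mem_Icc] at *; omega
  · intro k hk; rw [Finset.mem_Icc] at *; omega
  · intro k hk; rw [Finset.mem_Icc] at hk; omega
  · intro k hk; rw [Finset.mem_Icc] at hk; omega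
  · intro k hk
    have hk0 := natCast_ne_zero_of_mem_Icc hk
    rw [Finset.mem_Icc] at hk
    have h : (2 : ZMod p) ^ (p - k) * 2 ^ k = 2 := by
      rw [← pow_add, Nat.sub_add_cancel (by omega), ZMod.pow_card]
    have h' : (-1 : ZMod p) ^ m * (-1) ^ m = 1 := by rw [← mul_pow]; simp
    rw [natCast_prime_sub (by omega), neg_pow (k : ZMod p), mul_one_div,
      div_eq_div_iff (pow_ne_zero _ hk0) (by simp [h2, hk0])]
    linear_combination (-1) ^ m * (k : ZMod p) ^ m * h

/-- `x` is a `p`-integral rational whose residue modulo `p` is `z`. -/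
def HasResidue (x : ℚ) (z : ZMod p) : Prop :=
  ∃ a b : ℤ, (b : ZMod p) ≠ 0 ∧ x * b = a ∧ z * b = a

namespace HasResidue

lemma intCast (a : ℤ) : HasResidue (p := p) a a := ⟨a, 1, by simp⟩

variable {x y : ℚ} {z w : ZMod p}

lemma add (hx : HasResidue x z) (hy : HasResidue y w) : HasResidue (x + y) (z + w) := by
  obtain ⟨a, b, hb, h1, h2⟩ := hx
  obtain ⟨c, d, hd, h3, h4⟩ := hy
  refine ⟨a * d + c * b, b * d, by simp [hb, hd], ?_, ?_⟩
  · push_cast; linear_combination d * h1 + b * h3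
  · push_cast; linear_combination d * h2 + b * h4

lemma mul (hx : HasResidue x z) (hy : HasResidue y w) : HasResidue (x * y) (z * w) := by
  obtain ⟨a, b, hb, h1, h2⟩ := hx
  obtain ⟨c, d, hd, h3, h4⟩ := hy
  refine ⟨a * c, b * d, by simp [hb, hd], ?_, ?_⟩
  · push_cast; rw [← h1, ← h3]; ring
  · push_cast; rw [← h2, ← h4]; ring

lemma pow (hx : HasResidue x z) (n : ℕ) : HasResidue (x ^ n) (z ^ n) := by
  induction n with
  | zero => simpa using intCast (p := p) 1
  | succ n ih => simpa only [pow_succ] using ih.mul hx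

lemma inv (hx : HasResidue x z) (hz : z ≠ 0) : HasResidue x⁻¹ z⁻¹ := by
  obtain ⟨a, b, hb, h1, h2⟩ := hx
  have ha : (a : ZMod p) ≠ 0 := h2 ▸ mul_ne_zero hz hb
  have hx0 : x ≠ 0 := by
    rintro rfl
    have : a = 0 := by simpa using h1.symm
    simp [this] at ha
  exact ⟨b, a, ha, by rw [← h1, inv_mul_cancel_left₀ hx0], by
    rw [← h2, inv_mul_cancel_left₀ hz]⟩

lemma div (hx : HasResidue x z) (hy : HasResidue y w) (hw : w ≠ 0) :
    HasResidue (x / y) (z / w) := by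
  simpa only [div_eq_mul_inv] using hx.mul (hy.inv hw)

lemma sum {ι : Type*} {s : Finset ι} {f : ι → ℚ} {g : ι → ZMod p}
    (h : ∀ i ∈ s, HasResidue (f i) (g i)) : HasResidue (∑ i ∈ s, f i) (∑ i ∈ s, g i) := by
  classical
  induction s using Finset.induction_on with
  | empty => simpa using intCast (p := p) 0
  | insert a s ha ih =>
    rw [Finset.sum_insert ha, Finset.sum_insert ha]
    exact (h a (by simp)).add (ih fun i hi => h i (by simp [hi]))

lemma pcong (hx : HasResidue x z) (hy : HasResidue y z) : pcong p x y := by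
  obtain ⟨a, b, hb, h1, h2⟩ := hx.add ((intCast (-1)).mul hy)
  have ha : (p : ℤ) ∣ a := by
    rw [← ZMod.intCast_zmod_eq_zero_iff_dvd, ← h2]
    push_cast
    ring
  have hxy : (x - y) * b = a := by rw [← h1]; push_cast; ring
  have h : (x - y).num * b = a * (x - y).den := by
    have : (x - y) * (x - y).den = (x - y).num := Rat.mul_den_eq_num _
    have h' : ((x - y).num : ℚ) * b = a * (x - y).den := by
      rw [← this, ← hxy]; ring
    exact_mod_cast h'
  have hp : Prime (p : ℤ) := Nat.prime_iff_prime_int.mp Fact.out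
  refine (hp.dvd_or_dvd (h ▸ ha.mul_right _)).resolve_right fun hd => hb ?_
  exact (ZMod.intCast_zmod_eq_zero_iff_dvd _ _).mpr hd

lemma weight (s : ℤ) {k : ℕ} (hk : k ∈ Finset.Icc 1 (p - 1)) :
    HasResidue (sgn s ^ k / (k : ℚ) ^ s.natAbs) (weight (ZMod p) s k) := by
  refine div (pow ?_ k) (pow ?_ _) (pow_ne_zero _ (natCast_ne_zero_of_mem_Icc hk))
  · unfold sgn
    split_ifs
    · simpa using intCast (p := p) (-1)
    · simpa using intCast (p := p) 1
  · simpa using intCast (p := p) k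

lemma Hrev (l : List ℤ) {N : ℕ} (hN : N ≤ p - 1) :
    HasResidue (Hrev l N) (HrevField (ZMod p) l N) := by
  induction l generalizing N with
  | nil => simpa [_root_.Hrev, HrevField] using intCast (p := p) 1
  | cons s t ih =>
    refine sum fun k hk => ?_
    rw [Finset.mem_Icc] at hk
    exact (weight s (by rw [Finset.mem_Icc]; omega)).mul (ih (by omega))

lemma Srev (l : List ℤ) {N : ℕ} (hN : N ≤ p - 1) :
    HasResidue (Srev l N) (SrevField (ZMod p) l N) := by
  induction l generalizing N with
  | nil => simpa [_root_.Srev, SrevField] using intCast (p := p) 1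
  | cons s t ih =>
    refine sum fun k hk => ?_
    rw [Finset.mem_Icc] at hk
    exact (weight s (by rw [Finset.mem_Icc]; omega)).mul (ih (by omega))

lemma U1 (m : ℕ) :
    HasResidue (U1 m (p - 1)) (∑ k ∈ Finset.Icc 1 (p - 1), 2 ^ k / (k : ZMod p) ^ m) := by
  refine sum fun k hk => div (pow ?_ _) (pow ?_ _) (pow_ne_zero _ (natCast_ne_zero_of_mem_Icc hk))
  · simpa using intCast (p := p) 2
  · simpa using intCast (p := p) k

lemma V1 (m : ℕ) (h2 : (2 : ZMod p) ≠ 0) :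
    HasResidue (V1 m (p - 1))
      (∑ k ∈ Finset.Icc 1 (p - 1), 1 / ((2 : ZMod p) ^ k * (k : ZMod p) ^ m)) := by
  refine sum fun k hk => div ?_ (mul (pow ?_ _) (pow ?_ _))
    (mul_ne_zero (pow_ne_zero _ h2) (pow_ne_zero _ (natCast_ne_zero_of_mem_Icc hk)))
  · simpa using intCast (p := p) 1
  · simpa using intCast (p := p) 2
  · simpa using intCast (p := p) k

end HasResidue

end ModPrime

/-- The chain of congruences relating `H(-1,{1}ⁿ)`, `S(-1,{1}ⁿ)`, `H({1}ⁿ,-1)`,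
    `S({1}ⁿ,-1)`, `U(-n-1)` and `V(-n-1)` modulo `p`. -/
theorem neg_one_ones_congruences (n : ℕ) (p : ℕ) (hp : p.Prime) (hpn : n + 2 < p) :
    pcong p (H ((-1 : ℤ) :: List.replicate n 1) (p - 1))
      (S ((-1 : ℤ) :: List.replicate n 1) (p - 1)) ∧
    pcong p (S ((-1 : ℤ) :: List.replicate n 1) (p - 1))
      ((-1 : ℚ) ^ n * H (List.replicate n (1 : ℤ) ++ [-1]) (p - 1)) ∧
    pcong p ((-1 : ℚ) ^ n * H (List.replicate n (1 : ℤ) ++ [-1]) (p - 1))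
      ((-1 : ℚ) ^ n * S (List.replicate n (1 : ℤ) ++ [-1]) (p - 1)) ∧
    pcong p ((-1 : ℚ) ^ n * S (List.replicate n (1 : ℤ) ++ [-1]) (p - 1))
      (U1 (n + 1) (p - 1)) ∧
    pcong p (U1 (n + 1) (p - 1)) ((-1 : ℚ) ^ (n + 1) * 2 * V1 (n + 1) (p - 1)) := by
  have : Fact p.Prime := ⟨hp⟩
  have hp2 : p ≠ 2 := by omega
  have hn : n < p - 1 := by omega
  have h2 : (2 : ZMod p) ≠ 0 := by
    exact_mod_cast natCast_ne_zero_of_mem_Icc (p := p) (k := 2) (by rw [Finset.mem_Icc]; omega)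
  have hneg (m : ℕ) : HasResidue (p := p) ((-1) ^ m) ((-1) ^ m) :=
    HasResidue.pow (by simpa using HasResidue.intCast (p := p) (-1)) m
  have hHouter := (hneg n).mul (HasResidue.Hrev (p := p) (-1 :: List.replicate n 1) le_rfl)
  have hSouter := (hneg n).mul (HasResidue.Srev (p := p) (-1 :: List.replicate n 1) le_rfl)
  have hHinner := HasResidue.Hrev (p := p) (List.replicate n 1 ++ [-1]) le_rfl
  have hSinner := HasResidue.Srev (p := p) (List.replicate n 1 ++ [-1]) le_rfl
  have hV := ((hneg (n + 1)).mul (by simpa using HasResidue.intCast (p := p) 2)).mul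
    (HasResidue.V1 (n + 1) h2)
  have hHS : HrevField (ZMod p) (List.replicate n 1 ++ [-1]) (p - 1) =
      SrevField (ZMod p) (List.replicate n 1 ++ [-1]) (p - 1) := by
    rw [SrevField_inner_eq hn, ← SrevField_outer_eq hp2 hn, ← HrevField_inner_eq hn, ← mul_assoc,
      ← mul_pow]
    simp
  rw [SrevField_outer_eq hp2 hn, ← SrevField_inner_eq hn, SrevField_ones_neg_one hpn] at hSouter
  rw [← SrevField_inner_eq hn, SrevField_ones_neg_one hpn] at hHouter
  rw [hHS, SrevField_ones_neg_one hpn] at hHinner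
  rw [SrevField_ones_neg_one hpn] at hSinner
  rw [← sum_two_pow_div_pow] at hV
  simp only [H, S, List.reverse_cons, List.reverse_replicate, List.reverse_append,
    List.reverse_nil, List.nil_append, List.singleton_append]
  exact ⟨hHinner.pcong hSinner, hSinner.pcong hHouter, hHouter.pcong hSouter,
    hSouter.pcong (HasResidue.U1 _), (HasResidue.U1 _).pcong hV⟩
end
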